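/- (Pas's quantifier elimination.) If \theta(x_1,\ldots,x_m;\ell_1,\ldots,\ell_r) is a semi-algebraic condition, then the condition (\exists x_1 \in \bar{k}((t)))\,\theta(x_1,\ldots,x_m;\ell_1,\ldots,\ell_r) is again semi-algebraic. Furthermore, for any algebraically closed field K containing \bar{k}, the condition (\exists x_1 \in K((t)))\,\theta(x_1,\ldots,x_m;\ell_1,\ldots,\ell_r) is also semi-algebraic and may be defined by the same conditions, i.e. independently of K. -/

import Mathlib

noncomputable section
open scoped Classical

namespace Pas

/-- a polynomial of degree `≤ 1` over `ℤ` in the variables `ℓ₁, …, ℓ_r`: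
`L(ℓ) = c + ∑ aᵢ ℓᵢ` -/
structure AffineForm (r : ℕ) where
  c : ℤ
  a : Fin r → ℤ

/-- evaluation of an affine form -/
def AffineForm.eval {r : ℕ} (L : AffineForm r) (ℓ : Fin r → ℤ) : ℤ :=
  L.c + ∑ i, L.a i * ℓ i

/-- The syntax of semi-algebraic conditions `θ(x₁,…,x_m; ℓ₁,…,ℓ_r)`: finite
boolean combinations of conditions of the form
(i) `ord_t f₁(x) ≥ ord_t f₂(x) + L(ℓ₁,…,ℓ_r)`,
(ii) `ord_t f₁(x) ≡ L(ℓ₁,…,ℓ_r) mod d`, and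
(iii) `h(ac(f₁(x)), …, ac(f_{m'}(x))) = 0`,
where the `fᵢ` and `h` are polynomials over `k`, `L` is a polynomial of degree
`≤ 1` over `ℤ` and `d ∈ ℕ`. -/
inductive Cond (k : Type) [Field k] (m r : ℕ) : Type
  | ordGe (f₁ f₂ : MvPolynomial (Fin m) k) (L : AffineForm r) : Cond k m r
  | ordMod (f₁ : MvPolynomial (Fin m) k) (L : AffineForm r) (d : ℕ) : Cond k m r
  | acEq (m' : ℕ) (f : Fin m' → MvPolynomial (Fin m) k)
      (h : MvPolynomial (Fin m') k) : Cond k m r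
  | not (θ : Cond k m r) : Cond k m r
  | and (θ₁ θ₂ : Cond k m r) : Cond k m r
  | or (θ₁ θ₂ : Cond k m r) : Cond k m r

/-- `ord_t x ∈ ℤ ∪ {+∞}` : the order of a Laurent series, with `ord_t 0 = +∞`. -/
def ordT {K : Type} [Field K] (x : LaurentSeries K) : WithTop ℤ :=
  if x = 0 then ⊤ else (x.order : WithTop ℤ)

/-- `ac(x)` : the coefficient of lowest degree of `x ∈ K((t))` if `x ≠ 0`, and
`0` otherwise. -/
def ac {K : Type} [Field K] (x : LaurentSeries K) : K := x.coeff x.order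

/-- the congruence `o ≡ l mod d` on `ℤ ∪ {+∞}`, with the convention
`+∞ ≡ l mod d` for all `l` -/
def ModCond (o : WithTop ℤ) (l : ℤ) (d : ℕ) : Prop :=
  o = ⊤ ∨ ∃ z : ℤ, o = (z : WithTop ℤ) ∧ (d : ℤ) ∣ (z - l)

variable {k : Type} [Field k]

/-- evaluation of a polynomial over `k` at a point of `K((t))^m`, along a field
embedding `σ : k → K` -/
def evalPoly {K : Type} [Field K] (σ : k →+* K) {m : ℕ}
    (f : MvPolynomial (Fin m) k) (x : Fin m → LaurentSeries K) :
    LaurentSeries K :=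
  MvPolynomial.eval₂ ((HahnSeries.C : K →+* LaurentSeries K).comp σ) x f

/-- The interpretation of a semi-algebraic condition in
`K((t))^m × ℤ^r`, for `K` an (algebraically closed) field containing `k`. -/
def Cond.Holds {K : Type} [Field K] (σ : k →+* K) {m r : ℕ} :
    Cond k m r → (Fin m → LaurentSeries K) → (Fin r → ℤ) → Prop
  | .ordGe f₁ f₂ L, x, ℓ =>
      ordT (evalPoly σ f₂ x) + (L.eval ℓ : WithTop ℤ) ≤ ordT (evalPoly σ f₁ x)
  | .ordMod f₁ L d, x, ℓ => ModCond (ordT (evalPoly σ f₁ x)) (L.eval ℓ) d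
  | .acEq _ f h, x, _ =>
      MvPolynomial.eval₂ σ (fun i => ac (evalPoly σ (f i) x)) h = 0
  | .not θ, x, ℓ => ¬ θ.Holds σ x ℓ
  | .and θ₁ θ₂, x, ℓ => θ₁.Holds σ x ℓ ∧ θ₂.Holds σ x ℓ
  | .or θ₁ θ₂, x, ℓ => θ₁.Holds σ x ℓ ∨ θ₂.Holds σ x ℓ

section

/-- An algebraically closed field together with an embedding of `k`. -/
structure Mdl (k : Type) [Field k] where
  K : Type
  [field : Field K]
  [closed : IsAlgClosed K]
  σ : k →+* K

attribute [instance] Mdl.field Mdl.closed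

/-- Integral affine functions of finitely many among the variables indexed by `α`. -/
inductive IsAff {α : Type} : ((α → ℤ) → ℤ) → Prop
  | const (c : ℤ) : IsAff (fun _ => c)
  | var (i : α) : IsAff (fun v => v i)
  | add {ℓ ℓ' : (α → ℤ) → ℤ} : IsAff ℓ → IsAff ℓ' → IsAff (fun v => ℓ v + ℓ' v)
  | smul (n : ℤ) {ℓ : (α → ℤ) → ℤ} : IsAff ℓ → IsAff (fun v => n * ℓ v)

theorem IsAff.sub {α : Type} {ℓ ℓ' : (α → ℤ) → ℤ} (h : IsAff ℓ) (h' : IsAff ℓ') :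
    IsAff (fun v => ℓ v - ℓ' v) := by
  simpa [sub_eq_add_neg] using h.add (h'.smul (-1))

theorem IsAff.comp {α β : Type} {ℓ : (α → ℤ) → ℤ} (h : IsAff ℓ) {s : α → (β → ℤ) → ℤ}
    (hs : ∀ i, IsAff (s i)) : IsAff (fun v => ℓ (fun i => s i v)) := by
  induction h with
  | const c => exact .const c
  | var i => exact hs i
  | add _ _ h₁ h₂ => exact h₁.add h₂
  | smul n _ h => exact h.smul n

theorem IsAff.split {α : Type} {ℓ : (Option α → ℤ) → ℤ} (h : IsAff ℓ) :
    ∃ (a : ℤ) (ℓ₀ : (α → ℤ) → ℤ), IsAff ℓ₀ ∧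
      ∀ (z : ℤ) (v : α → ℤ), ℓ (fun o => o.elim z v) = a * z + ℓ₀ v := by
  induction h with
  | const c => exact ⟨0, _, .const c, by simp⟩
  | var i =>
    cases i with
    | none => exact ⟨1, _, .const 0, by simp⟩
    | some i => exact ⟨0, _, .var i, by simp⟩
  | add _ _ h₁ h₂ =>
    obtain ⟨a, l, hl, h⟩ := h₁
    obtain ⟨a', l', hl', h'⟩ := h₂
    exact ⟨a + a', _, hl.add hl', fun z v => by simp only [h, h']; ring⟩
  | smul n _ h =>
    obtain ⟨a, l, hl, h⟩ := h
    exact ⟨n * a, _, hl.smul n, fun z v => by simp only [h]; ring⟩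

/-- Uniform families of predicates on integer and residue field variables. -/
abbrev RPred (k : Type) [Field k] (α β : Type) : Type 1 :=
  (M : Mdl k) → (α → ℤ) → (β → M.K) → Prop

/-- Evaluation of polynomials over `k` at a point of the residue field. -/
abbrev Mdl.ev (M : Mdl k) {β : Type} (c : β → M.K) : MvPolynomial β k →+* M.K :=
  MvPolynomial.eval₂Hom M.σ c

/-- The atomic predicates: affine inequalities, congruences and polynomial equations. -/
inductive IsAtom {α β : Type} : RPred k α β → Prop
  | le {ℓ : (α → ℤ) → ℤ} (h : IsAff ℓ) : IsAtom (fun _ v _ => 0 ≤ ℓ v)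
  | dvd (d : ℤ) (hd : d ≠ 0) {ℓ : (α → ℤ) → ℤ} (h : IsAff ℓ) : IsAtom (fun _ v _ => d ∣ ℓ v)
  | eq (h : MvPolynomial β k) : IsAtom (fun M _ c => M.ev c h = 0)

/-- Boolean combinations of finitely many atomic predicates. -/
def QF {α β : Type} (R : RPred k α β) : Prop :=
  ∃ (I : Type) (_ : Finite I) (a : I → RPred k α β) (S : (I → Prop) → Prop),
    (∀ i, IsAtom (a i)) ∧ ∀ M v c, R M v c ↔ S (fun i => a i M v c)

namespace QF

variable {α β : Type}

theorem atom {R : RPred k α β} (h : IsAtom R) : QF R :=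
  ⟨Unit, inferInstance, fun _ => R, fun s => s (), fun _ => h, fun _ _ _ => Iff.rfl⟩

theorem congr {R R' : RPred k α β} (h : QF R) (e : ∀ M v c, R' M v c ↔ R M v c) : QF R' := by
  obtain ⟨I, hI, a, S, ha, hS⟩ := h
  exact ⟨I, hI, a, S, ha, fun M v c => (e M v c).trans (hS M v c)⟩

theorem bool {J : Type} [Finite J] {R : J → RPred k α β} (h : ∀ j, QF (R j))
    (S : (J → Prop) → Prop) : QF (fun M v c => S (fun j => R j M v c)) := by
  choose I hI a T ha hT using h
  refine ⟨Σ j, I j, inferInstance, fun x => a x.1 x.2,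
    fun s => S (fun j => T j (fun i => s ⟨j, i⟩)), fun x => ha _ _, fun M v c => ?_⟩
  simp only [hT]

theorem true : QF (fun _ _ _ => True : RPred k α β) :=
  bool (J := Empty) (R := fun _ _ _ _ => True) (fun j => j.elim) (fun _ => True)

theorem bool₁ {R : RPred k α β} (h : QF R) (S : Prop → Prop) : QF (fun M v c => S (R M v c)) :=
  bool (J := Unit) (R := fun _ => R) (fun _ => h) (fun s => S (s ()))

theorem not {R : RPred k α β} (h : QF R) : QF (fun M v c => ¬ R M v c) := h.bool₁ Not

theorem and {R R' : RPred k α β} (h : QF R) (h' : QF R') : QF (fun M v c => R M v c ∧ R' M v c) :=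
  bool (J := Bool) (R := fun b => bif b then R else R') (by rintro (_ | _) <;> assumption)
    (fun s => s Bool.true ∧ s Bool.false)

theorem or {R R' : RPred k α β} (h : QF R) (h' : QF R') : QF (fun M v c => R M v c ∨ R' M v c) :=
  bool (J := Bool) (R := fun b => bif b then R else R') (by rintro (_ | _) <;> assumption)
    (fun s => s Bool.true ∨ s Bool.false)

theorem all {J : Type} [Finite J] {R : J → RPred k α β} (h : ∀ j, QF (R j)) :
    QF (fun M v c => ∀ j, R j M v c) := bool h (fun s => ∀ j, s j)

theorem ex {J : Type} [Finite J] {R : J → RPred k α β} (h : ∀ j, QF (R j)) :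
    QF (fun M v c => ∃ j, R j M v c) := bool h (fun s => ∃ j, s j)

theorem comp {α' β' : Type} {R : RPred k α β} (h : QF R) {s : α → (α' → ℤ) → ℤ}
    (hs : ∀ i, IsAff (s i)) (p : β → MvPolynomial β' k) :
    QF (fun M v c => R M (fun i => s i v) (fun j => M.ev c (p j))) := by
  obtain ⟨I, hI, a, S, ha, hS⟩ := h
  refine ⟨I, hI, fun i M v c => a i M (fun i => s i v) (fun j => M.ev c (p j)), S,
    fun i => ?_, fun M v c => hS _ _ _⟩
  have hi := ha i
  beta_reduce
  generalize a i = A at hi ⊢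
  cases hi with
  | le h => exact .le (h.comp hs)
  | dvd d hd h => exact .dvd d hd (h.comp hs)
  | eq h =>
    have e : (fun M (_ : α' → ℤ) c => M.ev (fun j => M.ev c (p j)) h = 0 : RPred k α' β') =
        fun M _ c => M.ev c (MvPolynomial.bind₁ p h) = 0 := by
      funext M v c
      rw [Mdl.ev, Mdl.ev, MvPolynomial.eval₂Hom_bind₁]
    exact e ▸ .eq _

/-! ### Integer quantifiers -/

theorem _root_.Pas.IsAtom.shift {A : RPred k (Option α) β} (h : IsAtom A) :
    ∃ D : ℤ, 0 < D ∧ ∃ (a : ℤ) (ℓ : (α → ℤ) → ℤ), IsAff ℓ ∧ ∀ N : ℤ, D ∣ N → ∀ M z v c,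
      (a = 0 ∨ |a * N| < |a * z + ℓ v|) →
        (A M (fun o => o.elim (z + N) v) c ↔ A M (fun o => o.elim z v) c) := by
  cases h with
  | le h =>
    obtain ⟨a, ℓ, hℓ, e⟩ := h.split
    refine ⟨1, one_pos, a, ℓ, hℓ, fun N _ M z v c hz => ?_⟩
    simp only [e]
    rcases hz with rfl | hz
    · simp
    · rw [mul_add]
      rcases abs_cases (a * N) with h | h <;> rcases abs_cases (a * z + ℓ v) with h' | h' <;>
        constructor <;> intro <;> linarith
  | dvd d hd h =>
    obtain ⟨a, ℓ, hℓ, e⟩ := h.split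
    refine ⟨|d|, abs_pos.2 hd, 0, ℓ, hℓ, fun N hN M z v c _ => ?_⟩
    simp only [e]
    rw [show a * (z + N) + ℓ v = a * N + (a * z + ℓ v) by ring]
    exact dvd_add_right (((abs_dvd _ _).1 hN).mul_left a)
  | eq h => exact ⟨1, one_pos, 0, _, .const 0, fun N _ M z v c _ => Iff.rfl⟩

theorem subst_div {R : RPred k (Option α) β} (h : QF R) {a : ℤ} (ha : a ≠ 0)
    {m : (α → ℤ) → ℤ} (hm : IsAff m) :
    QF (fun M v c => a ∣ m v ∧ R M (fun o => o.elim (m v / a) v) c) := by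
  obtain ⟨I, hI, A, S, hA, hS⟩ := h
  have key : ∀ i, ∃ B : RPred k α β, QF B ∧ ∀ M v c, a ∣ m v →
      (A i M (fun o => o.elim (m v / a) v) c ↔ B M v c) := by
    intro i
    have hi := hA i
    generalize A i = A at hi ⊢
    cases hi with
    | le h =>
      obtain ⟨b, ℓ, hℓ, e⟩ := h.split
      refine ⟨_, .atom (.le ((hm.smul (a * b)).add (hℓ.smul (a ^ 2)))), fun M v c hd => ?_⟩
      obtain ⟨q, hq⟩ := hd
      simp only [e, hq, Int.mul_ediv_cancel_left _ ha]
      rw [show a * b * (a * q) + a ^ 2 * ℓ v = a ^ 2 * (b * q + ℓ v) by ring]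
      exact (mul_nonneg_iff_of_pos_left (by positivity)).symm
    | dvd d hd h =>
      obtain ⟨b, ℓ, hℓ, e⟩ := h.split
      refine ⟨_, .atom (.dvd (a * d) (mul_ne_zero ha hd) ((hm.smul b).add (hℓ.smul a))),
        fun M v c hd => ?_⟩
      obtain ⟨q, hq⟩ := hd
      simp only [e, hq, Int.mul_ediv_cancel_left _ ha]
      rw [show b * (a * q) + a * ℓ v = a * (b * q + ℓ v) by ring]
      exact (mul_dvd_mul_iff_left ha).symm
    | eq h => exact ⟨_, .atom (.eq h), fun _ _ _ _ => Iff.rfl⟩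
  choose B hB hAB using key
  refine ((atom (.dvd a ha hm)).and (bool hB S)).congr fun M v c => ?_
  refine and_congr_right fun hd => ?_
  rw [hS]
  simp only [hAB _ M v c hd]

theorem exZ {R : RPred k (Option α) β} (h : QF R) :
    QF (fun M v c => ∃ z : ℤ, R M (fun o => o.elim z v) c) := by
  have h' := h
  obtain ⟨I, hI, A, S, hA, hS⟩ := h
  cases nonempty_fintype I
  choose D hD a ℓ hℓ hsh using fun i => (hA i).shift
  set N : ℤ := ∏ i, D i with hN
  have hNpos : 0 < N := Finset.prod_pos fun i _ => hD i
  have hDN : ∀ i, D i ∣ N := fun i => Finset.dvd_prod_of_mem _ (Finset.mem_univ i)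
  have hR : ∀ n : ℤ, N ∣ n → ∀ M z v c, (∀ i, a i = 0 ∨ |a i * n| < |a i * z + ℓ i v|) →
      R M (fun o => o.elim z v) c → R M (fun o => o.elim (z + n) v) c := by
    intro n hn M z v c hz
    rw [hS, hS]
    simp only [hsh _ n ((hDN _).trans hn) M z v c (hz _), imp_self]
  have q₁ : QF (fun M v c => ∃ j : Fin N.toNat, (1 : ℤ) ∣ ((j : ℕ) : ℤ) ∧
      R M (fun o => o.elim (((j : ℕ) : ℤ) / 1) v) c) :=
    ex fun j => subst_div h' one_ne_zero (.const _)
  have q₂ : QF (fun M v c => ∃ i : {i // a i ≠ 0}, ∃ s : Set.Icc (-|a i * N|) |a i * N|,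
      a i ∣ s - ℓ i v ∧ R M (fun o => o.elim ((s - ℓ i v) / a i) v) c) :=
    ex fun i => ex fun s => subst_div h' i.2 ((IsAff.const _).sub (hℓ i))
  refine (q₁.or q₂).congr fun M v c => ⟨?_, ?_⟩
  · rintro ⟨z, hz⟩
    by_cases h0 : ∀ i, a i = 0
    · left
      have hlt := Int.emod_lt_of_pos z hNpos
      have hge := Int.emod_nonneg z hNpos.ne'
      refine ⟨⟨(z % N).toNat, by omega⟩, one_dvd _, ?_⟩
      have := hR (-(N * (z / N))) ((dvd_mul_right _ _).neg_right) M z v c (fun i => .inl (h0 i)) hz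
      rw [← sub_eq_add_neg, ← Int.emod_def] at this
      simpa [hge] using this
    · right
      push Not at h0
      obtain ⟨i₀, hi₀⟩ := h0
      induction hn : (a i₀ * z + ℓ i₀ v).natAbs using Nat.strong_induction_on generalizing z with
      | _ n ih =>
        by_cases hc : ∃ i, a i ≠ 0 ∧ |a i * z + ℓ i v| ≤ |a i * N|
        · obtain ⟨i, hi, hle⟩ := hc
          refine ⟨⟨i, hi⟩, ⟨a i * z + ℓ i v, abs_le.1 hle⟩, ?_⟩
          simpa [Int.mul_ediv_cancel_left _ hi] using hz
        · push Not at hc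
          have hlt := hc i₀ hi₀
          have hpos : 0 < |a i₀ * N| := abs_pos.2 (mul_ne_zero hi₀ hNpos.ne')
          have hup := hR N dvd_rfl M z v c (fun i => or_iff_not_imp_left.2 (hc i)) hz
          have hdown := hR (-N) (dvd_neg.2 dvd_rfl) M z v c
            (fun i => or_iff_not_imp_left.2 (by simpa using hc i)) hz
          by_cases hs : 0 < (a i₀ * z + ℓ i₀ v) * (a i₀ * N)
          · refine ih _ ?_ _ hdown rfl
            rw [← hn]
            zify
            rw [show a i₀ * (z + -N) + ℓ i₀ v = (a i₀ * z + ℓ i₀ v) - a i₀ * N by ring]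
            rcases pos_and_pos_or_neg_and_neg_of_mul_pos hs with ⟨h1, h2⟩ | ⟨h1, h2⟩
            · rw [abs_of_pos h1, abs_of_pos h2] at *
              rw [abs_of_pos] <;> linarith
            · rw [abs_of_neg h1, abs_of_neg h2] at *
              rw [abs_of_neg] <;> linarith
          · refine ih _ ?_ _ hup rfl
            rw [← hn]
            zify
            have hx : a i₀ * z + ℓ i₀ v ≠ 0 := by
              intro h; rw [h, abs_zero] at hlt; linarith
            have hs' : 0 < (a i₀ * z + ℓ i₀ v) * (-(a i₀ * N)) := by
              have := mul_ne_zero hx (abs_pos.1 hpos)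
              rw [mul_neg]
              exact neg_pos.2 (lt_of_le_of_ne (not_lt.1 hs) this)
            rw [show a i₀ * (z + N) + ℓ i₀ v = (a i₀ * z + ℓ i₀ v) + a i₀ * N by ring]
            rcases pos_and_pos_or_neg_and_neg_of_mul_pos hs' with ⟨h1, h2⟩ | ⟨h1, h2⟩
            · rw [abs_of_pos h1, abs_of_neg (neg_pos.1 h2)] at *
              rw [abs_of_pos] <;> linarith
            · rw [abs_of_neg h1, abs_of_pos (neg_neg_iff_pos.1 h2)] at *
              rw [abs_of_neg] <;> linarith
  · rintro (⟨j, -, hj⟩ | ⟨i, s, -, hs⟩)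
    exacts [⟨_, hj⟩, ⟨_, hs⟩]

end QF

end

section

/-! ### Residue field quantifiers -/

section
open Polynomial

theorem exists_pseudoDivision {R : Type} [CommRing R] [IsDomain R] (g : R[X]) (hg : g ≠ 0)
    (f : R[X]) :
    ∃ (N : ℕ) (q r : R[X]), C (g.leadingCoeff ^ N) * f = q * g + r ∧ r.degree < g.degree := by
  induction hn : f.natDegree using Nat.strong_induction_on generalizing f with
  | _ n ih =>
    by_cases hlt : f.degree < g.degree
    · exact ⟨0, 0, f, by simp, hlt⟩
    have hf : f ≠ 0 := by
      rintro rfl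
      exact hlt (by simpa [bot_lt_iff_ne_bot] using hg)
    have hle : g.natDegree ≤ f.natDegree := natDegree_le_natDegree (not_lt.1 hlt)
    have hlg : g.leadingCoeff ≠ 0 := leadingCoeff_ne_zero.2 hg
    set s := C f.leadingCoeff * X ^ (f.natDegree - g.natDegree) * g with hs
    have hs0 : s ≠ 0 := by simp [hs, hf, hg]
    by_cases h0 : C g.leadingCoeff * f - s = 0
    · exact ⟨1, C f.leadingCoeff * X ^ (f.natDegree - g.natDegree), 0,
        by rw [pow_one, ← hs, add_zero]; exact sub_eq_zero.1 h0,
        by simpa [bot_lt_iff_ne_bot] using hg⟩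
    have hdeg : (C g.leadingCoeff * f - s).degree < f.degree := by
      have h1 : (C g.leadingCoeff * f).degree = f.degree := degree_C_mul hlg
      rw [← h1]
      refine degree_sub_lt_left ?_ (by simp [hf, hg]) ?_
      · rw [h1, hs, degree_mul, degree_mul, degree_C (leadingCoeff_ne_zero.2 hf), degree_X_pow,
          degree_eq_natDegree hf, degree_eq_natDegree hg, zero_add]
        norm_cast
        omega
      · rw [hs, leadingCoeff_mul, leadingCoeff_mul, leadingCoeff_mul, leadingCoeff_C,
          leadingCoeff_C, leadingCoeff_X_pow, mul_one, mul_comm]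
    obtain ⟨N, q, r, h, hr⟩ := ih _ (hn ▸ natDegree_lt_natDegree h0 hdeg) _ rfl
    refine ⟨N + 1, q + C (g.leadingCoeff ^ N) * (C f.leadingCoeff *
      X ^ (f.natDegree - g.natDegree)), r, ?_, hr⟩
    have : C (g.leadingCoeff ^ (N + 1)) * f =
        C (g.leadingCoeff ^ N) * (C g.leadingCoeff * f - s) + C (g.leadingCoeff ^ N) * s := by
      rw [pow_succ, C_mul]; ring
    rw [this, h, hs]
    ring

theorem exists_root_not_root_iff {K : Type} [Field K] [IsAlgClosed K] (f g : K[X]) (hf : f ≠ 0) :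
    (∃ w, f.eval w = 0 ∧ g.eval w ≠ 0) ↔ ¬ f ∣ g ^ f.natDegree := by
  constructor
  · rintro ⟨w, hw, hg⟩ ⟨q, hq⟩
    have := congrArg (eval w) hq
    rw [eval_pow, eval_mul, hw, zero_mul] at this
    exact hg (eq_zero_of_pow_eq_zero this)
  · contrapose!
    intro h
    have hs := IsAlgClosed.splits f
    have hu : IsUnit (C f.leadingCoeff) := isUnit_C.2 (IsUnit.mk0 _ (leadingCoeff_ne_zero.2 hf))
    rw [hs.natDegree_eq_card_roots]
    conv_lhs => rw [hs.eq_prod_roots]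
    rw [hu.mul_left_dvd, ← Multiset.prod_replicate, ← Multiset.map_const]
    refine Multiset.prod_dvd_prod_of_dvd _ _ fun w hw => ?_
    rw [dvd_iff_isRoot]
    exact h w ((mem_roots hf).1 hw)

/-- The value of a polynomial with parameters. -/
abbrev Mdl.evP (M : Mdl k) {β : Type} (c : β → M.K) (f : (MvPolynomial β k)[X]) : M.K[X] :=
  f.map (M.ev c)

theorem QF.coeff_ne {α β : Type} (f : (MvPolynomial β k)[X]) :
    QF (fun M _ c => M.evP c f ≠ 0 : RPred k α β) := by
  refine ((QF.all (J := Fin (f.natDegree + 1)) fun j =>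
    QF.atom (IsAtom.eq (α := α) (f.coeff j))).not).congr fun M v c => not_congr ⟨?_, ?_⟩
  · intro h j
    have := congrArg (fun p => coeff p j) h
    simpa only [coeff_map, coeff_zero] using this
  · intro h
    ext j
    rw [coeff_map, coeff_zero]
    by_cases hj : j < f.natDegree + 1
    · exact h ⟨j, hj⟩
    · rw [coeff_eq_zero_of_natDegree_lt (by omega), map_zero]

/-- A measure of complexity for elimination. -/
def elimSize {R : Type} [Semiring R] (f : R[X]) : ℕ := if f = 0 then 1 else f.natDegree + 2

theorem elimSize_pos {R : Type} [Semiring R] (f : R[X]) : 0 < elimSize f := by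
  unfold elimSize; split_ifs <;> omega

theorem elimSize_lt {R : Type} [Semiring R] {f g : R[X]} (h : f.degree < g.degree) :
    elimSize f < elimSize g := by
  have hg : g ≠ 0 := by rintro rfl; simp at h
  unfold elimSize
  split_ifs with hf
  · omega
  · have := natDegree_lt_natDegree hf h
    omega

theorem Mdl.evP_eraseLead {M : Mdl k} {β : Type} {c : β → M.K} {f : (MvPolynomial β k)[X]}
    (h : M.ev c f.leadingCoeff = 0) : M.evP c f.eraseLead = M.evP c f := by
  conv_rhs => rw [← eraseLead_add_C_mul_X_pow f]
  rw [Mdl.evP, Mdl.evP, Polynomial.map_add, Polynomial.map_mul, map_C, h]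
  simp

theorem QF.ex_root_one {α β : Type} (g : (MvPolynomial β k)[X]) (f : (MvPolynomial β k)[X])
    (hf : f ≠ 0) :
    QF (fun M _ c => M.ev c f.leadingCoeff ≠ 0 ∧
      ∃ w, (M.evP c f).eval w = 0 ∧ (M.evP c g).eval w ≠ 0 : RPred k α β) := by
  obtain ⟨N, q, r, h, hr⟩ := exists_pseudoDivision f hf (g ^ f.natDegree)
  refine (((QF.atom (IsAtom.eq f.leadingCoeff)).not).and (QF.coeff_ne r)).congr fun M v c => ?_
  refine and_congr_right fun hl => ?_
  have hd : (M.evP c f).natDegree = f.natDegree := natDegree_map_of_leadingCoeff_ne_zero _ hl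
  have hd' : (M.evP c f).degree = f.degree := degree_map_eq_of_leadingCoeff_ne_zero _ hl
  have hf' : M.evP c f ≠ 0 := fun h0 => hl (by
    have := congrArg (fun p => coeff p f.natDegree) h0
    simpa only [coeff_map, coeff_zero, leadingCoeff] using this)
  rw [exists_root_not_root_iff _ _ hf', not_iff_not, hd]
  have h' := congrArg (M.evP c) h
  simp only [Polynomial.map_add, Polynomial.map_mul, map_C, Polynomial.map_pow] at h'
  have hu : IsUnit (C (M.ev c (f.leadingCoeff ^ N))) := by
    rw [isUnit_C, map_pow]
    exact (IsUnit.mk0 _ hl).pow N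
  rw [← hu.dvd_mul_left, h', dvd_add_right (dvd_mul_left _ _)]
  constructor
  · intro hdvd
    by_contra h0
    exact absurd (degree_le_of_dvd hdvd h0)
      (not_le.2 (hd' ▸ (degree_map_le).trans_lt hr))
  · intro h0
    rw [show map (M.ev c) r = 0 from h0]
    exact dvd_zero _

theorem QF.ex_root {α β : Type} (g : (MvPolynomial β k)[X]) (fs : Multiset (MvPolynomial β k)[X]) :
    QF (fun M _ c => ∃ w, (∀ f ∈ fs, (M.evP c f).eval w = 0) ∧ (M.evP c g).eval w ≠ 0 :
      RPred k α β) := by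
  induction hn : (fs.map elimSize).sum using Nat.strong_induction_on generalizing fs with
  | _ n ih =>
    rcases fs.empty_or_exists_mem with rfl | ⟨f, hf⟩
    · refine (QF.coeff_ne g).congr fun M v c => ⟨?_, ?_⟩
      · rintro ⟨w, -, hw⟩ h
        simp [h] at hw
      · intro h
        by_contra! hw
        exact h (Polynomial.funext fun w => by simpa using hw w)
    obtain ⟨rest, rfl⟩ := Multiset.exists_cons_of_mem hf
    have erase : ∀ (f : (MvPolynomial β k)[X]) (rest : Multiset (MvPolynomial β k)[X]), f ≠ 0 →
        ((f ::ₘ rest).map elimSize).sum = n →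
        QF (fun M _ c => M.ev c f.leadingCoeff = 0 ∧ ∃ w, (∀ p ∈ f ::ₘ rest,
          (M.evP c p).eval w = 0) ∧ (M.evP c g).eval w ≠ 0 : RPred k α β) := by
      intro f rest h0 hn
      refine ((QF.atom (IsAtom.eq f.leadingCoeff)).and
        (ih _ ?_ (f.eraseLead ::ₘ rest) rfl)).congr fun M v c => and_congr_right fun hl => ?_
      · rw [← hn]
        simpa using elimSize_lt (degree_eraseLead_lt h0)
      · simp only [Multiset.forall_mem_cons, Mdl.evP_eraseLead hl]
    by_cases h0 : f = 0
    · subst h0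
      refine (ih _ ?_ rest rfl).congr fun M v c => ?_
      · rw [← hn]
        simpa using elimSize_pos _
      · simp
    rcases rest.empty_or_exists_mem with rfl | ⟨f', hf'⟩
    · refine ((erase f 0 h0 hn).or (QF.ex_root_one g f h0)).congr fun M v c => ?_
      simp only [Multiset.forall_mem_cons, Multiset.notMem_zero, false_imp_iff, implies_true,
        and_true]
      rw [← or_and_right]
      exact (and_iff_right (em _)).symm
    obtain ⟨rest, rfl⟩ := Multiset.exists_cons_of_mem hf'
    have main : ∀ (f f' : (MvPolynomial β k)[X]), f ≠ 0 → f.degree ≤ f'.degree →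
        ((f ::ₘ f' ::ₘ rest).map elimSize).sum = n →
        QF (fun M _ c => ∃ w, (∀ p ∈ f ::ₘ f' ::ₘ rest,
          (M.evP c p).eval w = 0) ∧ (M.evP c g).eval w ≠ 0 : RPred k α β) := by
      intro f f' h0 hle hn
      obtain ⟨N, q, r, h, hr⟩ := exists_pseudoDivision f h0 f'
      refine ((erase f _ h0 hn).or (((QF.atom (IsAtom.eq f.leadingCoeff)).not).and
        (ih _ ?_ (f ::ₘ r ::ₘ rest) rfl))).congr fun M v c => ?_
      · rw [← hn]
        simpa using elimSize_lt (hr.trans_le hle)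
      · by_cases hl : M.ev c f.leadingCoeff = 0
        · simp only [hl, true_and, not_true, false_and, or_false]
        · simp only [hl, false_and, not_false_eq_true, true_and, false_or]
          refine exists_congr fun w => and_congr_left fun _ => ?_
          simp only [Multiset.forall_mem_cons]
          refine and_congr_right fun hw => and_congr_left fun _ => ?_
          have h' := congrArg (fun p => (M.evP c p).eval w) h
          simp only [Polynomial.map_add, Polynomial.map_mul, map_C, eval_add, eval_mul, hw,
            mul_zero, zero_add, eval_C] at h'
          rw [← h', mul_eq_zero, map_pow, or_iff_right (pow_ne_zero _ hl)]
    by_cases h0' : f' = 0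
    · subst h0'
      rw [Multiset.cons_swap] at hn
      refine (ih _ ?_ (f ::ₘ rest) rfl).congr fun M v c => ?_
      · rw [← hn]
        simpa using elimSize_pos _
      · simp
    rcases le_total f.degree f'.degree with hle | hle
    · exact main f f' h0 hle hn
    · rw [Multiset.cons_swap] at hn ⊢
      exact main f' f h0' hle hn

theorem Mdl.ev_option (M : Mdl k) {β : Type} (c : β → M.K) (w : M.K)
    (h : MvPolynomial (Option β) k) :
    M.ev (fun o => o.elim w c) h = (M.evP c (MvPolynomial.optionEquivLeft k β h)).eval w := by
  have : M.ev (fun o => o.elim w c) = ((evalRingHom w).comp (mapRingHom (M.ev c))).comp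
      (MvPolynomial.optionEquivLeft k β).toRingEquiv.toRingHom := by
    apply MvPolynomial.ringHom_ext
    · intro r; simp
    · rintro (_ | i) <;> simp
  rw [this]
  rfl

/-- Atomic predicates in an extended context: independent of the new variable, or a polynomial
equation. -/
theorem IsAtom.splitK {α β : Type} {A : RPred k α (Option β)} (h : IsAtom A) :
    (∃ B : RPred k α β, QF B ∧ ∀ M v c w, A M v (fun o => o.elim w c) ↔ B M v c) ∨
      ∃ f : (MvPolynomial β k)[X], ∀ M v c w,
        A M v (fun o => o.elim w c) ↔ (M.evP c f).eval w = 0 := by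
  cases h with
  | le h => exact .inl ⟨_, .atom (.le h), fun _ _ _ _ => Iff.rfl⟩
  | dvd d hd h => exact .inl ⟨_, .atom (.dvd d hd h), fun _ _ _ _ => Iff.rfl⟩
  | eq h => exact .inr ⟨_, fun M v c w => by
    rw [← M.ev_option c w h]⟩

theorem QF.exK {α β : Type} {R : RPred k α (Option β)} (h : QF R) :
    QF (fun M v c => ∃ w, R M v (fun o => o.elim w c)) := by
  obtain ⟨I, hI, A, S, hA, hS⟩ := h
  cases nonempty_fintype I
  have key : ∀ (i : I) (s : Prop), ∃ (B : RPred k α β) (f g : (MvPolynomial β k)[X]), QF B ∧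
      ∀ M v c w, ((A i M v (fun o => o.elim w c) ↔ s) ↔
        B M v c ∧ (M.evP c f).eval w = 0 ∧ (M.evP c g).eval w ≠ 0) := by
    intro i s
    rcases (hA i).splitK with ⟨B, hB, e⟩ | ⟨f, e⟩
    · exact ⟨_, 0, 1, hB.bool₁ (fun b => b ↔ s), fun M v c w => by simp [e]⟩
    · by_cases hs : s
      · exact ⟨_, f, 1, QF.true, fun M v c w => by simp [e, hs]⟩
      · exact ⟨_, 0, f, QF.true, fun M v c w => by simp [e, hs]⟩
  choose B f g hB hfg using key
  refine (QF.ex (J := {s : I → Prop // S s}) fun s => (QF.all fun i => hB i (s.1 i)).and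
    (QF.ex_root (∏ i, g i (s.1 i)) (Finset.univ.val.map fun i => f i (s.1 i)))).congr
    fun M v c => ?_
  have : ∀ (s : I → Prop) w, (fun i => A i M v (fun o => o.elim w c)) = s ↔
      (∀ i, B i (s i) M v c) ∧ (∀ f' ∈ (Finset.univ.val.map fun i => f i (s i)),
        (M.evP c f').eval w = 0) ∧ (M.evP c (∏ i, g i (s i))).eval w ≠ 0 := by
    intro s w
    rw [funext_iff]
    simp only [eq_iff_iff, hfg, forall_and, Polynomial.map_prod, eval_prod, Finset.prod_ne_zero_iff]
    simp
  constructor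
  · rintro ⟨w, hw⟩
    rw [hS] at hw
    obtain ⟨h1, h2⟩ := (this _ w).1 rfl
    exact ⟨⟨_, hw⟩, h1, w, h2⟩
  · rintro ⟨⟨s, hs⟩, h1, w, h2⟩
    refine ⟨w, (hS _ _ _).2 ?_⟩
    rwa [(this s w).2 ⟨h1, h2⟩]

end

end

section

theorem QF.rename {α β α' β' : Type} {R : RPred k α β} (h : QF R) (a : α → α') (b : β → β') :
    QF (fun M v c => R M (fun i => v (a i)) (fun j => c (b j))) :=
  (h.comp (fun i => IsAff.var (a i)) (fun j => MvPolynomial.X (b j))).congr fun M v c => by simp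

/-- Simultaneous elimination of tuples of integer and residue field variables. -/
theorem QF.exs {J : Type} [Finite J] {α β : Type} {R : RPred k (α ⊕ J) (β ⊕ J)} (h : QF R) :
    QF (fun M v c => ∃ (z : J → ℤ) (w : J → M.K), R M (Sum.elim v z) (Sum.elim c w)) := by
  have key : ∀ α β (R : RPred k (α ⊕ J) (β ⊕ J)), QF R →
      QF (fun M v c => ∃ (z : J → ℤ) (w : J → M.K), R M (Sum.elim v z) (Sum.elim c w)) := by
    refine Finite.induction_empty_option (P := fun J => ∀ α β (R : RPred k (α ⊕ J) (β ⊕ J)),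
      QF R → QF (fun M v c => ∃ (z : J → ℤ) (w : J → M.K),
        R M (Sum.elim v z) (Sum.elim c w))) ?_ ?_ ?_ J
    · intro J J' e ih α β R hR
      refine (ih _ _ _ (hR.rename (Sum.map id e.symm) (Sum.map id e.symm))).congr fun M v c => ?_
      have : ∀ {A B : Type} (f : B → A) (g : J → A), (fun i => Sum.elim f g (Sum.map id e.symm i)) =
          Sum.elim f (fun i => g (e.symm i)) := by
        intro A B f g
        funext i
        rcases i with i | i <;> rfl
      simp only [this]
      constructor
      · rintro ⟨z, w, hzw⟩
        exact ⟨fun i => z (e i), fun i => w (e i), by simpa using hzw⟩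
      · rintro ⟨z, w, hzw⟩
        exact ⟨_, _, hzw⟩
    · intro α β R hR
      refine (hR.rename (Sum.elim id PEmpty.elim) (Sum.elim id PEmpty.elim)).congr fun M v c => ?_
      have : ∀ {A B : Type} (f : B → A) (g : PEmpty → A),
          (fun i : B ⊕ PEmpty => f (Sum.elim id PEmpty.elim i)) = Sum.elim f g := by
        intro A B f g
        funext i
        rcases i with i | i
        · rfl
        · exact i.elim
      constructor
      · rintro ⟨z, w, hzw⟩
        rwa [this v z, this c w]
      · intro h
        refine ⟨PEmpty.elim, PEmpty.elim, ?_⟩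
        rwa [← this v PEmpty.elim, ← this c PEmpty.elim]
    · intro J _ ih α β R hR
      let s : (B : Type) → B ⊕ Option J → Option B ⊕ J := fun B =>
        Sum.elim (fun i => .inl (some i)) (fun o => o.elim (.inl none) .inr)
      refine ((ih _ _ _ (hR.rename (s α) (s β))).exK).exZ.congr fun M v c => ?_
      have : ∀ {A B : Type} (f : B → A) (g : Option J → A),
          (fun i => Sum.elim (fun o : Option B => o.elim (g none) f) (fun j => g (some j)) (s B i))
            = Sum.elim f g := by
        intro A B f g
        funext i
        rcases i with i | (_ | i) <;> rfl
      constructor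
      · rintro ⟨z, w, hzw⟩
        refine ⟨z none, w none, fun j => z (some j), fun j => w (some j), ?_⟩
        rwa [this, this]
      · rintro ⟨z₀, w₀, z, w, hzw⟩
        refine ⟨fun o => o.elim z₀ z, fun o => o.elim w₀ w, ?_⟩
        rw [← this, ← this]
        exact hzw
  exact key _ _ _ h

theorem IsAff.support {α : Type} {ℓ : (α → ℤ) → ℤ} (h : IsAff ℓ) :
    ∃ s : Finset α, ∀ v v' : α → ℤ, (∀ i ∈ s, v i = v' i) → ℓ v = ℓ v' := by
  induction h with
  | const c => exact ⟨∅, fun _ _ _ => rfl⟩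
  | var i => exact ⟨{i}, fun v v' h => h i (by simp)⟩
  | add _ _ h₁ h₂ =>
    obtain ⟨s, hs⟩ := h₁
    obtain ⟨t, ht⟩ := h₂
    refine ⟨s ∪ t, fun v v' h => ?_⟩
    beta_reduce
    rw [hs v v' fun i hi => h i (by simp [hi]), ht v v' fun i hi => h i (by simp [hi])]
  | smul n _ h =>
    obtain ⟨s, hs⟩ := h
    refine ⟨s, fun v v' h => ?_⟩
    beta_reduce
    rw [hs v v' h]

theorem QF.support {α : Type} {R : RPred k α α} (h : QF R) :
    ∃ s : Finset α, ∀ M (v v' : α → ℤ) (c c' : α → M.K), (∀ i ∈ s, v i = v' i) →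
      (∀ i ∈ s, c i = c' i) → (R M v c ↔ R M v' c') := by
  obtain ⟨I, hI, A, S, hA, hS⟩ := h
  cases nonempty_fintype I
  have key : ∀ i, ∃ s : Finset α, ∀ M (v v' : α → ℤ) (c c' : α → M.K), (∀ i ∈ s, v i = v' i) →
      (∀ i ∈ s, c i = c' i) → (A i M v c ↔ A i M v' c') := by
    intro i
    have hi := hA i
    generalize A i = A at hi ⊢
    cases hi with
    | le h =>
      obtain ⟨s, hs⟩ := h.support
      exact ⟨s, fun M v v' c c' hv _ => by beta_reduce; rw [hs v v' hv]⟩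
    | dvd d hd h =>
      obtain ⟨s, hs⟩ := h.support
      exact ⟨s, fun M v v' c c' hv _ => by beta_reduce; rw [hs v v' hv]⟩
    | eq h =>
      refine ⟨h.vars, fun M v v' c c' _ hc => ?_⟩
      have : M.ev c h = M.ev c' h :=
        MvPolynomial.eval₂Hom_congr' rfl (fun i hi _ => hc i hi) rfl
      beta_reduce
      rw [this]
  choose s hs using key
  refine ⟨Finset.univ.biUnion s, fun M v v' c c' hv hc => ?_⟩
  rw [hS, hS]
  have : ∀ i, A i M v c ↔ A i M v' c' := fun i =>
    hs i M v v' c c' (fun j hj => hv j (Finset.mem_biUnion.2 ⟨i, Finset.mem_univ i, hj⟩))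
      (fun j hj => hc j (Finset.mem_biUnion.2 ⟨i, Finset.mem_univ i, hj⟩))
  simp only [this]

/-- Points: a model, valued field coordinates indexed by `ι`, and leading term coordinates
(an integer and a residue field element) indexed by `κ`. -/
structure Pt (k : Type) [Field k] (ι κ : Type) where
  M : Mdl k
  x : ι → LaurentSeries M.K
  z : κ → ℤ
  c : κ → M.K

namespace Pt

variable {ι κ : Type}

/-- Evaluation of polynomials in the valued field coordinates. -/
abbrev vf (p : Pt k ι κ) : MvPolynomial ι k →+* LaurentSeries p.M.K :=
  MvPolynomial.eval₂Hom ((HahnSeries.C : p.M.K →+* LaurentSeries p.M.K).comp p.M.σ) p.x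

/-- All integers attached to a point. -/
def zs (p : Pt k ι κ) : MvPolynomial ι k ⊕ κ → ℤ := Sum.elim (fun f => (p.vf f).order) p.z

/-- All residue field elements attached to a point. -/
def cs (p : Pt k ι κ) : MvPolynomial ι k ⊕ κ → p.M.K := Sum.elim (fun f => ac (p.vf f)) p.c

/-- Adjoining leading term coordinates. -/
abbrev ext {J : Type} (p : Pt k ι κ) (z : J → ℤ) (c : J → p.M.K) : Pt k ι (κ ⊕ J) :=
  ⟨p.M, p.x, Sum.elim p.z z, Sum.elim p.c c⟩

/-- Forgetting leading term coordinates. -/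
abbrev base {J : Type} (p : Pt k ι (κ ⊕ J)) : Pt k ι κ :=
  ⟨p.M, p.x, fun i => p.z (.inl i), fun i => p.c (.inl i)⟩

/-- Adjoining a valued field coordinate. -/
abbrev push (p : Pt k ι κ) (y : LaurentSeries p.M.K) : Pt k (Option ι) κ :=
  ⟨p.M, fun o => o.elim y p.x, p.z, p.c⟩

/-- Forgetting a valued field coordinate. -/
abbrev pop (p : Pt k (Option ι) κ) : Pt k ι κ := ⟨p.M, fun i => p.x (some i), p.z, p.c⟩

/-- Evaluation of the coefficients of a polynomial. -/
abbrev poly (p : Pt k ι κ) (q : Polynomial (MvPolynomial ι k)) :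
    Polynomial (LaurentSeries p.M.K) := q.map p.vf

theorem vf_pop (p : Pt k (Option ι) κ) (f : MvPolynomial ι k) :
    p.pop.vf f = p.vf (MvPolynomial.rename some f) := by
  simp only [vf, MvPolynomial.coe_eval₂Hom, MvPolynomial.eval₂_rename]
  rfl

theorem vf_push (p : Pt k ι κ) (y : LaurentSeries p.M.K) (f : MvPolynomial (Option ι) k) :
    (p.push y).vf f = (p.poly (MvPolynomial.optionEquivLeft k ι f)).eval y := by
  have : (p.push y).vf = ((Polynomial.evalRingHom y).comp (Polynomial.mapRingHom p.vf)).comp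
      (MvPolynomial.optionEquivLeft k ι).toRingEquiv.toRingHom := by
    apply MvPolynomial.ringHom_ext
    · intro r; simp [push]
    · rintro (_ | i) <;> simp [push]
  rw [this]
  rfl

end Pt

variable {ι κ : Type}

/-- Recentering of a polynomial at a new valued field coordinate. -/
def recenter (q : Polynomial (MvPolynomial ι k)) : Polynomial (MvPolynomial (Option ι) k) :=
  Polynomial.taylor (MvPolynomial.X none)
    (q.map (MvPolynomial.rename (R := k) (some : ι → Option ι)).toRingHom)

theorem natDegree_recenter_le (q : Polynomial (MvPolynomial ι k)) :
    (recenter q).natDegree ≤ q.natDegree := by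
  rw [recenter, Polynomial.natDegree_taylor]
  exact Polynomial.natDegree_map_le

theorem Pt.poly_recenter (p : Pt k ι κ) (y : LaurentSeries p.M.K)
    (q : Polynomial (MvPolynomial ι k)) :
    (p.push y).poly (recenter q) = Polynomial.taylor y (p.poly q) := by
  rw [Pt.poly, recenter, Polynomial.map_taylor, Polynomial.map_map]
  congr 1
  · simp [Pt.push]
  · congr 1
    refine RingHom.ext fun f => ?_
    exact ((p.push y).vf_pop f).symm

/-- Definable predicates. -/
def Def (P : Pt k ι κ → Prop) : Prop :=
  ∃ R : RPred k (MvPolynomial ι k ⊕ κ) (MvPolynomial ι k ⊕ κ), QF R ∧ ∀ p, P p ↔ R p.M p.zs p.cs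

/-- Integer valued terms. -/
def IsZ (f : Pt k ι κ → ℤ) : Prop :=
  ∃ ℓ : (MvPolynomial ι k ⊕ κ → ℤ) → ℤ, IsAff ℓ ∧ ∀ p, f p = ℓ p.zs

/-- Residue field valued terms. -/
def IsK (f : (p : Pt k ι κ) → p.M.K) : Prop :=
  ∃ h : MvPolynomial (MvPolynomial ι k ⊕ κ) k, ∀ p, f p = p.M.ev p.cs h

namespace IsZ

theorem const (n : ℤ) : IsZ (fun _ : Pt k ι κ => n) := ⟨_, .const n, fun _ => rfl⟩

theorem var (i : κ) : IsZ (fun p : Pt k ι κ => p.z i) := ⟨_, .var (.inr i), fun _ => rfl⟩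

theorem order (f : MvPolynomial ι k) : IsZ (fun p : Pt k ι κ => (p.vf f).order) :=
  ⟨_, .var (.inl f), fun _ => rfl⟩

theorem add {f g : Pt k ι κ → ℤ} (hf : IsZ f) (hg : IsZ g) : IsZ (fun p => f p + g p) := by
  obtain ⟨l, hl, e⟩ := hf
  obtain ⟨l', hl', e'⟩ := hg
  exact ⟨_, hl.add hl', fun p => by beta_reduce; rw [e, e']⟩

theorem smul (n : ℤ) {f : Pt k ι κ → ℤ} (hf : IsZ f) : IsZ (fun p => n * f p) := by
  obtain ⟨l, hl, e⟩ := hf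
  exact ⟨_, hl.smul n, fun p => by beta_reduce; rw [e]⟩

theorem sub {f g : Pt k ι κ → ℤ} (hf : IsZ f) (hg : IsZ g) : IsZ (fun p => f p - g p) := by
  simpa [sub_eq_add_neg] using hf.add (hg.smul (-1))

theorem base {J : Type} {f : Pt k ι κ → ℤ} (hf : IsZ f) :
    IsZ (fun p : Pt k ι (κ ⊕ J) => f p.base) := by
  obtain ⟨l, hl, e⟩ := hf
  refine ⟨_, hl.comp (fun i => IsAff.var (Sum.map id Sum.inl i)), fun p => ?_⟩
  beta_reduce
  rw [e]
  congr 1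
  funext i
  rcases i with i | i <;> rfl

theorem pop {f : Pt k ι κ → ℤ} (hf : IsZ f) : IsZ (fun p : Pt k (Option ι) κ => f p.pop) := by
  obtain ⟨l, hl, e⟩ := hf
  refine ⟨_, hl.comp (fun i => IsAff.var (Sum.map (MvPolynomial.rename some) id i)), fun p => ?_⟩
  beta_reduce
  rw [e]
  congr 1
  funext i
  rcases i with i | i
  · exact congrArg HahnSeries.order (p.vf_pop i)
  · rfl

end IsZ

namespace IsK

theorem nat (n : ℕ) : IsK (fun _ : Pt k ι κ => n) :=
  ⟨(n : MvPolynomial _ k), fun _ => (map_natCast _ n).symm⟩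

theorem zero : IsK (fun _ : Pt k ι κ => 0) := ⟨0, fun _ => (map_zero _).symm⟩

theorem var (i : κ) : IsK (fun p : Pt k ι κ => p.c i) :=
  ⟨MvPolynomial.X (.inr i), fun p => by simp [Pt.cs]⟩

theorem ac (f : MvPolynomial ι k) : IsK (fun p : Pt k ι κ => ac (p.vf f)) :=
  ⟨MvPolynomial.X (.inl f), fun p => by simp [Pt.cs]⟩

theorem add {f g : (p : Pt k ι κ) → p.M.K} (hf : IsK f) (hg : IsK g) :
    IsK (fun p => f p + g p) := by
  obtain ⟨l, e⟩ := hf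
  obtain ⟨l', e'⟩ := hg
  exact ⟨l + l', fun p => by beta_reduce; rw [e, e', map_add]⟩

theorem mul {f g : (p : Pt k ι κ) → p.M.K} (hf : IsK f) (hg : IsK g) :
    IsK (fun p => f p * g p) := by
  obtain ⟨l, e⟩ := hf
  obtain ⟨l', e'⟩ := hg
  exact ⟨l * l', fun p => by beta_reduce; rw [e, e', map_mul]⟩

theorem neg {f : (p : Pt k ι κ) → p.M.K} (hf : IsK f) : IsK (fun p => - f p) := by
  obtain ⟨l, e⟩ := hf
  exact ⟨-l, fun p => by beta_reduce; rw [e, map_neg]⟩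

theorem pow {f : (p : Pt k ι κ) → p.M.K} (hf : IsK f) (n : ℕ) : IsK (fun p => f p ^ n) := by
  obtain ⟨l, e⟩ := hf
  exact ⟨l ^ n, fun p => by beta_reduce; rw [e, map_pow]⟩

theorem sum {I : Type} (s : Finset I) {f : I → (p : Pt k ι κ) → p.M.K} (hf : ∀ i, IsK (f i)) :
    IsK (fun p => ∑ i ∈ s, f i p) := by
  choose l e using hf
  exact ⟨∑ i ∈ s, l i, fun p => by simp only [e, map_sum]⟩

theorem base {J : Type} {f : (p : Pt k ι κ) → p.M.K} (hf : IsK f) :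
    IsK (fun p : Pt k ι (κ ⊕ J) => f p.base) := by
  obtain ⟨l, e⟩ := hf
  refine ⟨MvPolynomial.rename (Sum.map id Sum.inl) l, fun p => ?_⟩
  beta_reduce
  rw [e, Mdl.ev, Mdl.ev, MvPolynomial.coe_eval₂Hom, MvPolynomial.coe_eval₂Hom,
    MvPolynomial.eval₂_rename]
  congr 1
  funext i
  rcases i with i | i <;> rfl

theorem pop {f : (p : Pt k ι κ) → p.M.K} (hf : IsK f) :
    IsK (fun p : Pt k (Option ι) κ => f p.pop) := by
  obtain ⟨l, e⟩ := hf
  refine ⟨MvPolynomial.rename (Sum.map (MvPolynomial.rename some) id) l, fun p => ?_⟩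
  beta_reduce
  rw [e, Mdl.ev, Mdl.ev, MvPolynomial.coe_eval₂Hom, MvPolynomial.coe_eval₂Hom,
    MvPolynomial.eval₂_rename]
  congr 1
  funext i
  rcases i with i | i
  · exact congrArg Pas.ac (p.vf_pop i)
  · rfl

end IsK

namespace Def

variable {P P' : Pt k ι κ → Prop}

theorem congr (h : Def P) (e : ∀ p, P' p ↔ P p) : Def P' := by
  obtain ⟨R, hR, h⟩ := h
  exact ⟨R, hR, fun p => (e p).trans (h p)⟩

theorem bool {J : Type} [Finite J] {P : J → Pt k ι κ → Prop} (h : ∀ j, Def (P j))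
    (S : (J → Prop) → Prop) : Def (fun p => S (fun j => P j p)) := by
  choose R hR e using h
  exact ⟨_, QF.bool hR S, fun p => by simp only [e]⟩

theorem prop (S : Prop) : Def (fun _ : Pt k ι κ => S) :=
  bool (J := Empty) (P := fun _ _ => True) (fun j => j.elim) (fun _ => S)

theorem not (h : Def P) : Def (fun p => ¬ P p) :=
  bool (J := Unit) (P := fun _ => P) (fun _ => h) (fun s => ¬ s ())

theorem and (h : Def P) (h' : Def P') : Def (fun p => P p ∧ P' p) :=
  bool (J := Bool) (P := fun b => bif b then P else P') (by rintro (_ | _) <;> assumption)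
    (fun s => s Bool.true ∧ s Bool.false)

theorem or (h : Def P) (h' : Def P') : Def (fun p => P p ∨ P' p) :=
  bool (J := Bool) (P := fun b => bif b then P else P') (by rintro (_ | _) <;> assumption)
    (fun s => s Bool.true ∨ s Bool.false)

theorem all {J : Type} [Finite J] {P : J → Pt k ι κ → Prop} (h : ∀ j, Def (P j)) :
    Def (fun p => ∀ j, P j p) := bool h (fun s => ∀ j, s j)

theorem ex {J : Type} [Finite J] {P : J → Pt k ι κ → Prop} (h : ∀ j, Def (P j)) :
    Def (fun p => ∃ j, P j p) := bool h (fun s => ∃ j, s j)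

theorem nonneg {f : Pt k ι κ → ℤ} (hf : IsZ f) : Def (fun p => 0 ≤ f p) := by
  obtain ⟨l, hl, e⟩ := hf
  exact ⟨_, QF.atom (.le hl), fun p => by beta_reduce; rw [e]⟩

theorem le {f g : Pt k ι κ → ℤ} (hf : IsZ f) (hg : IsZ g) : Def (fun p => f p ≤ g p) :=
  (nonneg (hg.sub hf)).congr fun _ => sub_nonneg.symm

theorem lt {f g : Pt k ι κ → ℤ} (hf : IsZ f) (hg : IsZ g) : Def (fun p => f p < g p) :=
  (le hg hf).not.congr fun _ => not_le.symm

theorem eqZ {f g : Pt k ι κ → ℤ} (hf : IsZ f) (hg : IsZ g) : Def (fun p => f p = g p) :=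
  ((le hf hg).and (le hg hf)).congr fun _ => le_antisymm_iff

theorem dvd (d : ℤ) {f : Pt k ι κ → ℤ} (hf : IsZ f) : Def (fun p => d ∣ f p) := by
  by_cases hd : d = 0
  · subst hd
    exact (eqZ hf (.const 0)).congr fun p => zero_dvd_iff
  · obtain ⟨l, hl, e⟩ := hf
    exact ⟨_, QF.atom (.dvd d hd hl), fun p => by beta_reduce; rw [e]⟩

theorem eq_zero {f : (p : Pt k ι κ) → p.M.K} (hf : IsK f) : Def (fun p => f p = 0) := by
  obtain ⟨l, e⟩ := hf
  exact ⟨_, QF.atom (.eq l), fun p => by beta_reduce; rw [e]⟩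

theorem eqK {f g : (p : Pt k ι κ) → p.M.K} (hf : IsK f) (hg : IsK g) :
    Def (fun p => f p = g p) :=
  (eq_zero (hf.add hg.neg)).congr fun _ => by rw [← sub_eq_add_neg, sub_eq_zero]

theorem vf_eq_zero (f : MvPolynomial ι k) : Def (fun p : Pt k ι κ => p.vf f = 0) :=
  (eq_zero (IsK.ac f)).congr fun p => by rw [Pas.ac, HahnSeries.coeff_order_eq_zero]

theorem poly_eq_zero (q : Polynomial (MvPolynomial ι k)) :
    Def (fun p : Pt k ι κ => p.poly q = 0) := by
  refine (all (J := Fin (q.natDegree + 1)) fun j => vf_eq_zero (q.coeff j)).congr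
    fun p => ⟨?_, ?_⟩
  · intro h j
    have := congrArg (fun p => Polynomial.coeff p j) h
    simpa only [Polynomial.coeff_map, Polynomial.coeff_zero] using this
  · intro h
    ext1 j
    rw [Polynomial.coeff_map, Polynomial.coeff_zero]
    by_cases hj : j < q.natDegree + 1
    · exact h ⟨j, hj⟩
    · rw [Polynomial.coeff_eq_zero_of_natDegree_lt (by omega), map_zero]

theorem base {J : Type} (h : Def P) : Def (fun p : Pt k ι (κ ⊕ J) => P p.base) := by
  obtain ⟨R, hR, e⟩ := h
  refine ⟨_, hR.rename (Sum.map id Sum.inl) (Sum.map id Sum.inl), fun p => ?_⟩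
  beta_reduce
  rw [e]
  refine iff_of_eq ?_
  congr 1 <;> (funext i; rcases i with i | i <;> rfl)

theorem exRV {J : Type} [Finite J] {P : Pt k ι (κ ⊕ J) → Prop} (h : Def P) :
    Def (fun p : Pt k ι κ => ∃ (z : J → ℤ) (c : J → p.M.K), P (p.ext z c)) := by
  obtain ⟨R, hR, e⟩ := h
  let a := (Equiv.sumAssoc (MvPolynomial ι k) κ J).symm
  refine ⟨_, (hR.rename a a).exs, fun p => ?_⟩
  refine exists_congr fun z => exists_congr fun c => ?_
  rw [e]
  refine iff_of_eq ?_
  congr 1 <;> (funext i; rcases i with i | (i | i) <;> rfl)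

/-- A definable predicate depends on a valued field coordinate only through the leading terms of
finitely many polynomials. -/
theorem split {P : Pt k (Option ι) κ → Prop} (h : Def P) :
    ∃ (L : Type) (_ : Finite L) (f : L → Polynomial (MvPolynomial ι k))
      (P' : Pt k ι (κ ⊕ L) → Prop), Def P' ∧ ∀ (p : Pt k ι κ) (y : LaurentSeries p.M.K),
        P (p.push y) ↔ P' (p.ext (fun l => ((p.poly (f l)).eval y).order)
          (fun l => ac ((p.poly (f l)).eval y))) := by
  obtain ⟨R, hR, e⟩ := h
  obtain ⟨s, hs⟩ := hR.support
  let L := {f : MvPolynomial (Option ι) k // Sum.inl f ∈ s}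
  have hL : Finite L := by
    refine Finite.of_injective (β := s) (fun f => ⟨.inl f.1, f.2⟩) fun f g h => ?_
    exact Subtype.ext (Sum.inl_injective (congrArg Subtype.val h))
  let a : MvPolynomial (Option ι) k ⊕ κ → Option (MvPolynomial ι k ⊕ (κ ⊕ L)) :=
    Sum.elim (fun f => if hf : .inl f ∈ s then some (.inr (.inr ⟨f, hf⟩)) else none)
      (fun i => some (.inr (.inl i)))
  refine ⟨L, hL, fun f => MvPolynomial.optionEquivLeft k ι f.1, fun p =>
    R p.M (fun i => (a i).elim 0 p.zs) (fun i => p.M.ev p.cs ((a i).elim 0 MvPolynomial.X)),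
    ⟨_, hR.comp (s := fun i v => (a i).elim 0 v) (fun i => ?_) (fun i => (a i).elim 0 MvPolynomial.X),
      fun p => Iff.rfl⟩, fun p y => ?_⟩
  · rcases a i with _ | i
    · exact .const 0
    · exact .var i
  · beta_reduce
    rw [e]
    refine hs _ _ _ _ _ (fun i hi => ?_) (fun i hi => ?_)
    · rcases i with f | i
      · simp only [a, Sum.elim_inl, dif_pos hi]
        exact congrArg HahnSeries.order (p.vf_push y f)
      · rfl
    · rcases i with f | i
      · simp only [a, Sum.elim_inl, dif_pos hi, Option.elim]
        rw [MvPolynomial.coe_eval₂Hom, MvPolynomial.eval₂_X]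
        exact congrArg Pas.ac (p.vf_push y f)
      · simp only [a, Sum.elim_inr, Option.elim]
        rw [MvPolynomial.coe_eval₂Hom, MvPolynomial.eval₂_X]
        rfl

theorem push_vf {P : Pt k (Option ι) κ → Prop} (h : Def P) (f : MvPolynomial ι k) :
    Def (fun p : Pt k ι κ => P (p.push (p.vf f))) := by
  obtain ⟨R, hR, e⟩ := h
  let a : MvPolynomial (Option ι) k ⊕ κ → MvPolynomial ι k ⊕ κ :=
    Sum.map (MvPolynomial.bind₁ (fun o => o.elim f MvPolynomial.X)) id
  refine ⟨_, hR.rename a a, fun p => ?_⟩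
  have hf : ∀ g, (p.push (p.vf f)).vf g =
      p.vf (MvPolynomial.bind₁ (fun o => o.elim f MvPolynomial.X) g) := by
    intro g
    rw [Pt.vf, Pt.vf, MvPolynomial.eval₂Hom_bind₁]
    congr 2
    funext o
    rcases o with _ | o
    · rfl
    · simp [Pt.push]
  beta_reduce
  rw [e]
  refine iff_of_eq ?_
  congr 1 <;> (
    funext i
    rcases i with i | i
    · first | exact congrArg HahnSeries.order (hf i) | exact congrArg Pas.ac (hf i)
    · rfl)

/-- Gluing of definable predicates along a finite definable cover. -/
theorem glue {I : Type} [Finite I] {C Q : I → Pt k ι κ → Prop} (hC : ∀ i, Def (C i))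
    (hQ : ∀ i, Def (Q i)) {H T : Pt k ι κ → Prop} (hc : ∀ p, H p → ∃ i, C i p)
    (hT : ∀ i p, H p → C i p → (Q i p ↔ T p)) :
    ∃ Q' : Pt k ι κ → Prop, Def Q' ∧ ∀ p, H p → (Q' p ↔ T p) := by
  refine ⟨_, ex fun i => (hC i).and (hQ i), fun p hp => ⟨?_, fun ht => ?_⟩⟩
  · rintro ⟨i, hi, hq⟩
    exact (hT i p hp hi).1 hq
  · obtain ⟨i, hi⟩ := hc p hp
    exact ⟨i, hi, (hT i p hp hi).2 ht⟩

end Def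

end

section

/-! ### Leading terms of Laurent series -/

section

variable {K : Type} [Field K]

/-- `x = a tⁿ` up to terms of higher degree. -/
def Lead (x : LaurentSeries K) (n : ℤ) (a : K) : Prop :=
  (∀ m < n, x.coeff m = 0) ∧ x.coeff n = a

namespace Lead

variable {x y : LaurentSeries K} {n m : ℤ} {a b : K}

theorem zero (n : ℤ) : Lead (0 : LaurentSeries K) n 0 := ⟨fun _ _ => rfl, rfl⟩

theorem of_lt (h : Lead x n a) (hm : m < n) : Lead x m 0 :=
  ⟨fun i hi => h.1 i (hi.trans hm), h.1 m hm⟩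

theorem add (hx : Lead x n a) (hy : Lead y n b) : Lead (x + y) n (a + b) :=
  ⟨fun i hi => by rw [HahnSeries.coeff_add, hx.1 i hi, hy.1 i hi, add_zero],
    by rw [HahnSeries.coeff_add, hx.2, hy.2]⟩

theorem sub (hx : Lead x n a) (hy : Lead y n b) : Lead (x - y) n (a - b) :=
  ⟨fun i hi => by rw [HahnSeries.coeff_sub, hx.1 i hi, hy.1 i hi, sub_zero],
    by rw [HahnSeries.coeff_sub, hx.2, hy.2]⟩

theorem sum {I : Type} (s : Finset I) {x : I → LaurentSeries K} {a : I → K}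
    (h : ∀ i ∈ s, Lead (x i) n (a i)) : Lead (∑ i ∈ s, x i) n (∑ i ∈ s, a i) := by
  induction s using Finset.cons_induction with
  | empty => exact zero n
  | cons i s hi ih =>
    rw [Finset.sum_cons, Finset.sum_cons]
    exact (h i (by simp)).add (ih fun j hj => h j (by simp [hj]))

theorem mul (hx : Lead x n a) (hy : Lead y m b) : Lead (x * y) (n + m) (a * b) := by
  constructor
  · intro i hi
    rw [HahnSeries.coeff_mul]
    refine Finset.sum_eq_zero fun ij hij => ?_
    rw [Finset.mem_antidiagonal] at hij
    by_cases h : ij.1 < n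
    · rw [hx.1 _ h, zero_mul]
    · rw [hy.1 ij.2 (by linarith [hij.2.2]), mul_zero]
  · rw [HahnSeries.coeff_mul, ← hx.2, ← hy.2]
    refine Finset.sum_eq_single (n, m) (fun ij hij hne => ?_) (fun hnot => ?_)
    · rw [Finset.mem_antidiagonal] at hij
      by_cases h : ij.1 < n
      · rw [hx.1 _ h, zero_mul]
      · by_cases h' : ij.2 < m
        · rw [hy.1 _ h', mul_zero]
        · exact absurd (Prod.ext (by linarith [hij.2.2] : ij.1 = n) (by linarith [hij.2.2])) hne
    · by_contra h
      refine hnot (Finset.mem_antidiagonal.2 ⟨?_, ?_, rfl⟩)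
      · exact left_ne_zero_of_mul h
      · exact right_ne_zero_of_mul h

theorem const (a : K) : Lead (HahnSeries.C a : LaurentSeries K) 0 a := by
  constructor
  · intro i hi
    rw [HahnSeries.C_apply, HahnSeries.coeff_single_of_ne hi.ne]
  · rw [HahnSeries.C_apply, HahnSeries.coeff_single_same]

theorem single (n : ℤ) (a : K) : Lead (HahnSeries.single n a) n a :=
  ⟨fun _ hi => HahnSeries.coeff_single_of_ne hi.ne, HahnSeries.coeff_single_same _ _⟩

theorem pow (hx : Lead x n a) (i : ℕ) : Lead (x ^ i) (i * n) (a ^ i) := by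
  induction i with
  | zero => simpa using const (1 : K)
  | succ i ih =>
    rw [pow_succ, pow_succ, show ((i + 1 : ℕ) : ℤ) * n = i * n + n by push_cast; ring]
    exact ih.mul hx

theorem natCast_mul (hx : Lead x n a) (N : ℕ) : Lead ((N : LaurentSeries K) * x) n (N * a) := by
  have := (const (N : K)).mul hx
  rwa [map_natCast, zero_add] at this

theorem ne_zero (h : Lead x n a) (ha : a ≠ 0) : x ≠ 0 := by
  rintro rfl
  exact ha h.2.symm

theorem order_eq (h : Lead x n a) (ha : a ≠ 0) : x.order = n := by
  refine le_antisymm (HahnSeries.order_le_of_coeff_ne_zero (h.2.symm ▸ ha)) ?_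
  by_contra hlt
  exact h.ne_zero ha (HahnSeries.coeff_order_eq_zero.1 (h.1 _ (not_le.1 hlt)))

theorem ac_eq (h : Lead x n a) (ha : a ≠ 0) : ac x = a := by
  rw [ac, h.order_eq ha, h.2]

theorem refl (x : LaurentSeries K) : Lead x x.order (ac x) :=
  ⟨fun _ hi => HahnSeries.coeff_eq_zero_of_lt_order hi, rfl⟩

theorem lt_order (h : Lead x n 0) (hx : x ≠ 0) : n < x.order := by
  by_contra hlt
  refine hx (HahnSeries.coeff_order_eq_zero.1 ?_)
  rcases (not_lt.1 hlt).lt_or_eq with hlt | he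
  · exact h.1 _ hlt
  · rw [he, h.2]

theorem exists_powerSeries (h : Lead x n a) :
    ∃ f : PowerSeries K, x = HahnSeries.single n 1 * HahnSeries.ofPowerSeries ℤ K f ∧
      PowerSeries.constantCoeff f = a := by
  refine ⟨PowerSeries.mk fun i => x.coeff (n + i), ?_, by simpa using h.2⟩
  ext i
  rw [show i = (i - n) + n by ring, HahnSeries.coeff_single_mul_add, one_mul]
  rcases lt_or_ge (i - n) 0 with hi | hi
  · rw [h.1 _ (by linarith), PowerSeries.coeff_coe, if_pos hi]
  · obtain ⟨j, hj⟩ := Int.eq_ofNat_of_zero_le hi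
    rw [hj, HahnSeries.ofPowerSeries_apply_coeff, PowerSeries.coeff_mk, add_comm]

end Lead

theorem ac_eq_zero {x : LaurentSeries K} : ac x = 0 ↔ x = 0 := HahnSeries.coeff_order_eq_zero

theorem ac_zero : ac (0 : LaurentSeries K) = 0 := ac_eq_zero.2 rfl

/-! ### Newton polygons -/

open Polynomial

/-- `f(t^γ X) = t^w (r(X) + terms of positive order)`. -/
def Gauss (f : (LaurentSeries K)[X]) (γ w : ℤ) (r : K[X]) : Prop :=
  ∀ i : ℕ, Lead (f.coeff i) (w - i * γ) (r.coeff i)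

namespace Gauss

variable {f : (LaurentSeries K)[X]} {γ w : ℤ} {r : K[X]} {u : LaurentSeries K} {ξ : K}

theorem eval (h : Gauss f γ w r) (hu : Lead u γ ξ) : Lead (f.eval u) w (r.eval ξ) := by
  rw [eval_eq_sum_range' (n := max f.natDegree r.natDegree + 1) (by omega),
    eval_eq_sum_range' (p := r) (n := max f.natDegree r.natDegree + 1) (by omega)]
  refine Lead.sum _ fun i _ => ?_
  have := (h i).mul (hu.pow i)
  rwa [sub_add_cancel] at this

theorem hasseDeriv (h : Gauss f γ w r) (m : ℕ) :
    Gauss (hasseDeriv m f) γ (w - m * γ) (Polynomial.hasseDeriv m r) := by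
  intro i
  rw [hasseDeriv_coeff, hasseDeriv_coeff]
  have := (h (i + m)).natCast_mul ((i + m).choose m)
  rwa [show w - m * γ - i * γ = w - ((i + m : ℕ) : ℤ) * γ by push_cast; ring]

theorem taylor (h : Gauss f γ w r) (hu : Lead u γ ξ) :
    Gauss (taylor u f) γ w (Polynomial.taylor ξ r) := by
  intro i
  rw [taylor_coeff, taylor_coeff]
  exact (h.hasseDeriv i).eval hu

theorem natDegree_le {γ' w' : ℤ} {r' : K[X]} {e : ℕ} (h : Gauss f γ w r) (hr : r.coeff e ≠ 0)
    (hγ : γ < γ') (h' : Gauss f γ' w' r') : r'.natDegree ≤ e := by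
  rw [natDegree_le_iff_coeff_eq_zero]
  intro i hi
  have h1 : w' - e * γ' ≤ w - e * γ := by
    by_contra hlt
    exact hr ((h e).2.symm.trans ((h' e).1 _ (not_le.1 hlt)))
  rw [← (h' i).2]
  refine (h i).1 _ ?_
  have : ((e : ℤ) + 1) ≤ i := by exact_mod_cast hi
  nlinarith

end Gauss

theorem exists_taylor_coeff_ne_zero {r : K[X]} (hr : r ≠ 0) {e : ℕ} (he : r.natDegree ≤ e)
    (ξ : K) : ∃ i ≤ e, (taylor ξ r).coeff i ≠ 0 :=
  ⟨r.natDegree, he, by rw [coeff_taylor_natDegree]; exact leadingCoeff_ne_zero.2 hr⟩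

theorem exists_taylor_coeff_ne_zero_of_coeff_eq_zero [CharZero K] {r : K[X]} (hr : r ≠ 0) {n : ℕ}
    (he : r.natDegree ≤ n + 1) (hn : r.coeff n = 0) {ξ : K} (hξ : ξ ≠ 0) :
    ∃ i ≤ n, (taylor ξ r).coeff i ≠ 0 := by
  rcases he.lt_or_eq with he | he
  · exact exists_taylor_coeff_ne_zero hr (by omega) ξ
  · refine ⟨n, le_rfl, ?_⟩
    have hl : r.coeff (n + 1) ≠ 0 := by
      rw [← he]
      exact leadingCoeff_ne_zero.2 hr
    rw [taylor_coeff, eval_eq_sum_range' (n := 2), Finset.sum_range_succ, Finset.sum_range_one,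
      hasseDeriv_coeff, hasseDeriv_coeff, zero_add, hn, mul_zero, zero_mul, zero_add, add_comm 1 n,
      Nat.choose_succ_self_right]
    · exact mul_ne_zero (mul_ne_zero (by exact_mod_cast n.succ_ne_zero) hl) (pow_ne_zero _ hξ)
    · have := natDegree_hasseDeriv_le r n
      omega

/-! ### Hensel's lemma -/

theorem exists_root_of_constantCoeff_coeff_one_ne_zero (P : (PowerSeries K)[X])
    (h0 : PowerSeries.constantCoeff (P.coeff 0) = 0)
    (h1 : PowerSeries.constantCoeff (P.coeff 1) ≠ 0) :
    ∃ y, PowerSeries.constantCoeff y = 0 ∧ P.eval y = 0 := by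
  set d := P.natDegree with hd
  set I : Ideal (PowerSeries K) := Ideal.span {PowerSeries.X} with hI
  have memI : ∀ x : PowerSeries K, x ∈ I ↔ PowerSeries.constantCoeff x = 0 := fun x => by
    rw [hI, Ideal.mem_span_singleton, PowerSeries.X_dvd_iff]
  set φ : PowerSeries K →+* K := PowerSeries.constantCoeff with hφ
  set Q : (PowerSeries K)[X] :=
    ∑ i ∈ Finset.range (d + 1), C (P.coeff (i + 1) * P.coeff 0 ^ i) * X ^ (d - i) with hQ
  have hmonic : (X ^ (d + 1) + Q).Monic := by
    refine monic_X_pow_add (Finset.sum_induction _ (fun p : (PowerSeries K)[X] =>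
      p.degree < (d + 1 : ℕ)) (fun p q hp hq => (degree_add_le _ _).trans_lt (max_lt hp hq))
      (by simp) fun i _ => (degree_C_mul_X_pow_le _ _).trans_lt ?_)
    exact_mod_cast (by omega : d - i < d + 1)
  have hmap : (X ^ (d + 1) + Q).map φ = X ^ d * (X + C (φ (P.coeff 1))) := by
    rw [hQ, Finset.sum_range_succ', Polynomial.map_add, Polynomial.map_add, Polynomial.map_sum,
      Finset.sum_eq_zero]
    · simp only [Polynomial.map_pow, map_X, Polynomial.map_mul, map_C, pow_zero, mul_one,
        Nat.sub_zero, zero_add]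
      ring
    · intro i _
      simp [h0]
  have heval : ∀ p : (PowerSeries K)[X], ∀ x, φ (p.eval x) = (p.map φ).eval (φ x) :=
    fun p x => by rw [eval_map, eval₂_at_apply]
  obtain ⟨a, ha, ha'⟩ := HenselianRing.is_henselian (I := I) _ hmonic (-P.coeff 1)
    (by rw [memI, heval, hmap]; simp)
    (by
      refine IsUnit.map _ (PowerSeries.isUnit_iff_constantCoeff.2 (isUnit_iff_ne_zero.2 ?_))
      rw [← hφ, heval, ← derivative_map, hmap]
      simp only [derivative_mul, eval_add, eval_mul, eval_X, eval_C, map_neg, derivative_X,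
        derivative_C, eval_pow, neg_add_cancel, mul_zero, zero_add, add_zero, mul_one,
        derivative_add]
      exact pow_ne_zero _ (neg_ne_zero.2 h1))
  have hau : IsUnit a := by
    refine PowerSeries.isUnit_iff_constantCoeff.2 (isUnit_iff_ne_zero.2 ?_)
    rw [memI, map_sub, map_neg, sub_neg_eq_add] at ha'
    intro h
    rw [h, zero_add] at ha'
    exact h1 ha'
  obtain ⟨b, hb⟩ := hau.exists_right_inv
  refine ⟨P.coeff 0 * b, by rw [map_mul, h0, zero_mul], ?_⟩
  have key : a ^ (d + 1) * P.eval (P.coeff 0 * b) = P.coeff 0 * (X ^ (d + 1) + Q).eval a := by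
    rw [eval_eq_sum_range' (n := d + 2) (by omega), Finset.sum_range_succ', hQ, eval_add,
      eval_finsetSum, mul_add, mul_add, Finset.mul_sum, Finset.mul_sum, add_comm]
    congr 1
    · simp [mul_comm]
    · refine Finset.sum_congr rfl fun i hi => ?_
      have hi : i ≤ d := Nat.lt_succ_iff.1 (Finset.mem_range.1 hi)
      have : a ^ (d + 1) * b ^ (i + 1) = a ^ (d - i) := by
        rw [show d + 1 = (d - i) + (i + 1) by omega, pow_add, mul_assoc, ← mul_pow, hb, one_pow,
          mul_one]
      simp only [eval_mul, eval_C, eval_pow, eval_X]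
      rw [← this]
      ring
  rw [ha, mul_zero] at key
  exact (hau.pow _).mul_right_eq_zero.1 key

theorem Gauss.exists_root {f : (LaurentSeries K)[X]} {γ w : ℤ} {r : K[X]} {ξ : K}
    (h : Gauss f γ w r) (h0 : r.eval ξ = 0) (h1 : r.derivative.eval ξ ≠ 0) :
    ∃ β, Lead β γ ξ ∧ f.eval β = 0 := by
  have hF := h.taylor (Lead.single γ ξ)
  set F := Polynomial.taylor (HahnSeries.single γ ξ) f with hFdef
  choose c hc hc' using fun i => (hF i).exists_powerSeries
  set ψ := HahnSeries.ofPowerSeries ℤ K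
  set P : (PowerSeries K)[X] := ∑ i ∈ Finset.range (F.natDegree + 2), C (c i) * X ^ i with hP
  have hPc : ∀ i < F.natDegree + 2, P.coeff i = c i := by
    intro i hi
    rw [hP, finsetSum_coeff, Finset.sum_eq_single i]
    · simp
    · intro j _ hj
      rw [coeff_C_mul_X_pow, if_neg hj.symm]
    · intro hn
      exact absurd (Finset.mem_range.2 hi) hn
  obtain ⟨y, hy, hy'⟩ := exists_root_of_constantCoeff_coeff_one_ne_zero P
    (by rw [hPc 0 (by omega), hc', taylor_coeff_zero, h0])
    (by rwa [hPc 1 (by omega), hc', taylor_coeff_one])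
  have hv : Lead (HahnSeries.single γ 1 * ψ y) γ 0 := by
    have : Lead (ψ y) 0 0 := by
      constructor
      · intro m hm
        rw [PowerSeries.coeff_coe, if_pos hm]
      · have := HahnSeries.ofPowerSeries_apply_coeff (Γ := ℤ) (R := K) y 0
        rw [Nat.cast_zero] at this
        rw [this, PowerSeries.coeff_zero_eq_constantCoeff, hy]
    simpa using (Lead.single γ (1 : K)).mul this
  refine ⟨HahnSeries.single γ 1 * ψ y + HahnSeries.single γ ξ, by
    simpa using hv.add (Lead.single γ ξ), ?_⟩
  rw [← taylor_eval, ← hFdef, eval_eq_sum_range' (n := F.natDegree + 2) (by omega)]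
  have : HahnSeries.single w 1 * ψ (P.eval y) = 0 := by rw [hy', map_zero, mul_zero]
  rw [← this, hP, eval_finsetSum, map_sum, Finset.mul_sum]
  refine Finset.sum_congr rfl fun i _ => ?_
  rw [hc, mul_pow, HahnSeries.single_pow, one_pow, nsmul_eq_mul, eval_mul, eval_C, eval_pow,
    eval_X, map_mul, map_pow]
  have : (HahnSeries.single w 1 : LaurentSeries K) =
      HahnSeries.single (w - i * γ) 1 * HahnSeries.single (i * γ) 1 := by
    rw [HahnSeries.single_mul_single, sub_add_cancel, one_mul]
  rw [this]
  ring

/-- On the class of series with leading term `ξ t^γ`, the polynomial `f` has a unique zero, and its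
leading term is `η t^ω` times that of the distance to this zero. -/
def LinRoot (f : (LaurentSeries K)[X]) (γ : ℤ) (ξ : K) (ω : ℤ) (η : K) : Prop :=
  η ≠ 0 ∧ ∃ α, Lead α γ ξ ∧ f.eval α = 0 ∧ ∀ u, Lead u γ ξ → u ≠ α →
    Lead (f.eval u) (ω + (u - α).order) (η * ac (u - α))

theorem Gauss.linRoot {f : (LaurentSeries K)[X]} {γ w : ℤ} {r : K[X]} {ξ : K}
    (h : Gauss f γ w r) (h0 : r.eval ξ = 0) (h1 : r.derivative.eval ξ ≠ 0) :
    LinRoot f γ ξ (w - γ) (r.derivative.eval ξ) := by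
  obtain ⟨α, hα, hf⟩ := h.exists_root h0 h1
  refine ⟨h1, α, hα, hf, fun u hu hne => ?_⟩
  have hF := h.taylor hα
  have hlt : γ < (u - α).order := by
    have := hu.sub hα
    rw [sub_self] at this
    exact this.lt_order (sub_ne_zero.2 hne)
  rw [show u = (u - α) + α by ring, ← taylor_eval, add_sub_cancel_right]
  set v := u - α
  rw [eval_eq_sum_range' (n := (Polynomial.taylor α f).natDegree + 2) (by omega),
    Finset.sum_range_succ', Finset.sum_range_succ', taylor_coeff_zero, hf, zero_mul, add_zero]
  rw [show (r.derivative.eval ξ * ac v) = 0 + (r.derivative.eval ξ * ac v) by rw [zero_add]]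
  refine Lead.add ?_ ?_
  · rw [← Finset.sum_const_zero (s := Finset.range (Polynomial.taylor α f).natDegree)]
    refine Lead.sum _ fun i _ => ?_
    refine ((hF (i + 1 + 1)).mul ((Lead.refl v).pow (i + 1 + 1))).of_lt ?_
    push_cast
    nlinarith
  · have := (hF 1).mul ((Lead.refl v).pow 1)
    rw [taylor_coeff_one] at this
    simpa [taylor_coeff_one] using this

theorem LinRoot.taylor {f : (LaurentSeries K)[X]} {γ ω γ' : ℤ} {ξ η ξ' : K}
    {β : LaurentSeries K} (h : LinRoot f γ ξ ω η) (hβ : Lead β γ ξ) (hγ : γ < γ')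
    (h0 : f.eval β ≠ 0) (ho : (f.eval β).order = ω + γ')
    (ha : ac (f.eval β) = -(η * ξ')) : LinRoot (taylor β f) γ' ξ' ω η := by
  obtain ⟨hη, α, hα, hf, hu⟩ := h
  refine ⟨hη, α - β, ?_, ?_, fun v hv hne => ?_⟩
  · have hne : β ≠ α := fun h => h0 (h ▸ hf)
    have hs : ac (β - α) ≠ 0 := fun h => hne (sub_eq_zero.1 (ac_eq_zero.1 h))
    have hl := hu β hβ hne
    rw [hl.order_eq (mul_ne_zero hη hs), add_right_inj] at ho
    rw [hl.ac_eq (mul_ne_zero hη hs), ← mul_neg] at ha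
    have := (Lead.refl (β - α))
    rw [ho, mul_left_cancel₀ hη ha] at this
    simpa using (Lead.zero γ').sub this
  · rw [taylor_eval, sub_add_cancel, hf]
  · rw [taylor_eval, show v - (α - β) = v + β - α by ring]
    refine hu _ ?_ fun h => hne (by rw [← h]; ring)
    simpa using (hv.of_lt hγ).add hβ

end

end

section

/-! ### Simultaneous leading term conditions -/

section

open Polynomial

variable {K : Type} [Field K]

theorem Gauss.natDegree_le_natDegree {f : (LaurentSeries K)[X]} {γ w : ℤ} {r : K[X]}
    (h : Gauss f γ w r) : r.natDegree ≤ f.natDegree := by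
  rw [natDegree_le_iff_coeff_eq_zero]
  intro i hi
  rw [← (h i).2, coeff_eq_zero_of_natDegree_lt hi, HahnSeries.coeff_zero]

theorem Gauss.ne_zero {f : (LaurentSeries K)[X]} {γ w : ℤ} {r : K[X]} (h : Gauss f γ w r)
    (hr : r ≠ 0) : f ≠ 0 := by
  rintro rfl
  refine hr (Polynomial.ext fun i => ?_)
  rw [← (h i).2, coeff_zero, coeff_zero, HahnSeries.coeff_zero]

theorem Gauss.linRoot_hasseDeriv [CharZero K] {f : (LaurentSeries K)[X]} {γ w : ℤ} {r : K[X]}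
    {ξ : K} {n : ℕ} (h : Gauss f γ w r) (h0 : (Polynomial.taylor ξ r).coeff n = 0)
    (h1 : (Polynomial.taylor ξ r).coeff (n + 1) ≠ 0) :
    LinRoot (Polynomial.hasseDeriv n f) γ ξ (w - n * γ - γ)
      ((n + 1 : ℕ) * (Polynomial.taylor ξ r).coeff (n + 1)) := by
  have hd : (Polynomial.hasseDeriv n r).derivative.eval ξ =
      (n + 1 : ℕ) * (Polynomial.taylor ξ r).coeff (n + 1) := by
    have := congrArg (fun F => F r) (Polynomial.hasseDeriv_comp (R := K) 1 n)
    simp only [LinearMap.comp_apply, hasseDeriv_one, LinearMap.smul_apply] at this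
    rw [this, taylor_coeff, Nat.choose_one_right, nsmul_eq_mul, eval_mul, eval_natCast, add_comm 1 n]
  rw [← hd]
  refine (h.hasseDeriv n).linRoot (by rwa [← taylor_coeff]) ?_
  rw [hd]
  exact mul_ne_zero (by exact_mod_cast n.succ_ne_zero) h1

theorem LinRoot.ne_zero {f : (LaurentSeries K)[X]} {γ ω : ℤ} {ξ η : K} (h : LinRoot f γ ξ ω η) :
    f ≠ 0 := by
  rintro rfl
  obtain ⟨hη, α, hα, -, hu⟩ := h
  have h1 := Lead.single (γ + 1) (1 : K)
  have hs : Lead (α + HahnSeries.single (γ + 1) 1) γ ξ := by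
    simpa using hα.add (h1.of_lt (lt_add_one γ))
  have := hu _ hs fun h => by simp at h
  rw [add_sub_cancel_left, h1.ac_eq one_ne_zero] at this
  exact this.ne_zero (mul_ne_zero hη one_ne_zero) eval_zero

variable {J : Type}

/-- Some zero of `q` with leading term `ξ t^γ` gives the `f j` prescribed leading terms. -/
def Match (f : J → (LaurentSeries K)[X]) (q : (LaurentSeries K)[X]) (γ : ℤ) (ξ : K) (z : J → ℤ)
    (c : J → K) : Prop :=
  ∃ u, Lead u γ ξ ∧ q.eval u = 0 ∧ ∀ j, ((f j).eval u).order = z j ∧ ac ((f j).eval u) = c j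

/-- Admissible data: `q` vanishes or has a linear root, and `ξ` is a zero of multiplicity at most
`e j` of the initial form of `f j`. -/
def Adm (f : J → (LaurentSeries K)[X]) (q : (LaurentSeries K)[X]) (γ : ℤ) (ξ : K) (ω : ℤ) (η : K)
    (e : J → ℕ) : Prop :=
  ξ ≠ 0 ∧ (q = 0 ∨ LinRoot q γ ξ ω η) ∧
    ∀ j w r, Gauss (f j) γ w r → r ≠ 0 → ∃ i ≤ e j, (taylor ξ r).coeff i ≠ 0

theorem Adm.recenter [CharZero K] {f : J → (LaurentSeries K)[X]} {q : (LaurentSeries K)[X]}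
    {γ ω : ℤ} {ξ η : K} {e : J → ℕ} (h : Adm f q γ ξ ω η e)
    (hG : ∀ l, f l ≠ 0 → ∃ w r, r ≠ 0 ∧ Gauss (f l) γ w r) {β : LaurentSeries K}
    (hβ : Lead β γ ξ) {j : J} {n : ℕ} {w : ℤ} {r : K[X]} (hj : Gauss (f j) γ w r)
    (hr : (taylor ξ r).coeff (n + 1) ≠ 0) (h0 : (hasseDeriv n (f j)).eval β = 0) {γ' : ℤ} {ξ' : K}
    (hγ : γ < γ') (hξ' : ξ' ≠ 0)
    (hq : q = 0 ∨ q.eval β ≠ 0 ∧ (q.eval β).order = ω + γ' ∧ ac (q.eval β) = -(η * ξ')) :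
    Adm (fun l => taylor β (f l)) (taylor β q) γ' ξ' ω η (Function.update e j n) := by
  obtain ⟨hξ, hq', hf⟩ := h
  refine ⟨hξ', ?_, fun l w' r' hg hr' => ?_⟩
  · rcases hq with rfl | ⟨h1, h2, h3⟩
    · exact .inl (map_zero _)
    · rcases hq' with rfl | hq'
      · exact absurd eval_zero h1
      · exact .inr (hq'.taylor hβ hγ h1 h2 h3)
  · by_cases hl : l = j
    · subst hl
      rw [Function.update_self]
      refine exists_taylor_coeff_ne_zero_of_coeff_eq_zero hr'
        ((hj.taylor hβ).natDegree_le hr hγ hg) ?_ hξ'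
      rw [← (hg n).2, taylor_coeff, h0, HahnSeries.coeff_zero]
    · rw [Function.update_of_ne hl]
      obtain ⟨w₀, r₀, hr₀, hg₀⟩ := hG l fun h => hg.ne_zero hr' (by simp only [h, map_zero])
      obtain ⟨m, hm, hm'⟩ := hf l w₀ r₀ hg₀ hr₀
      exact exists_taylor_coeff_ne_zero hr' (((hg₀.taylor hβ).natDegree_le hm' hγ hg).trans hm) ξ'

theorem match_iff_recenter {f : J → (LaurentSeries K)[X]} {q : (LaurentSeries K)[X]}
    {γ ω : ℤ} {ξ η : K} {z : J → ℤ} {c : J → K} (hq : q = 0 ∨ LinRoot q γ ξ ω η)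
    {β : LaurentSeries K} (hβ : Lead β γ ξ) :
    Match f q γ ξ z c ↔
      (q.eval β = 0 ∧ ∀ j, ((f j).eval β).order = z j ∧ ac ((f j).eval β) = c j) ∨
      ∃ γ' ξ', γ < γ' ∧ ξ' ≠ 0 ∧
        (q = 0 ∨ q.eval β ≠ 0 ∧ (q.eval β).order = ω + γ' ∧ ac (q.eval β) = -(η * ξ')) ∧
        Match (fun l => taylor β (f l)) (taylor β q) γ' ξ' z c := by
  constructor
  · rintro ⟨u, hu, hqu, hfu⟩
    by_cases hne : u = β
    · subst hne
      exact .inl ⟨hqu, hfu⟩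
    · have hs : u - β ≠ 0 := sub_ne_zero.2 hne
      refine .inr ⟨(u - β).order, ac (u - β), ?_, fun h => hs (ac_eq_zero.1 h), ?_, u - β,
        Lead.refl _, ?_, fun j => ?_⟩
      · have := hu.sub hβ
        rw [sub_self] at this
        exact this.lt_order hs
      · rcases hq with rfl | ⟨hη, α, hα, -, hq⟩
        · exact .inl rfl
        · right
          have huα : u = α := by
            by_contra h
            refine (hq u hu h).ne_zero (mul_ne_zero hη fun h' => h ?_) hqu
            exact sub_eq_zero.1 (ac_eq_zero.1 h')
          subst huα
          have hl := hq β hβ (Ne.symm hne)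
          have ha : ac (β - u) = -ac (u - β) := by
            rw [← neg_sub, ac, ac, HahnSeries.order_neg, HahnSeries.coeff_neg]
          have hn : η * ac (β - u) ≠ 0 :=
            mul_ne_zero hη fun h => hne (sub_eq_zero.1 (ac_eq_zero.1 h)).symm
          refine ⟨hl.ne_zero hn, ?_, ?_⟩
          · rw [hl.order_eq hn, ← neg_sub, HahnSeries.order_neg]
          · rw [hl.ac_eq hn, ha, mul_neg]
      · rw [taylor_eval, sub_add_cancel, hqu]
      · rw [taylor_eval, sub_add_cancel]
        exact hfu j
  · rintro (⟨hqβ, hfβ⟩ | ⟨γ', ξ', hγ, -, -, v, hv, hqv, hfv⟩)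
    · exact ⟨β, hβ, hqβ, hfβ⟩
    · refine ⟨v + β, by simpa using (hv.of_lt hγ).add hβ, by rwa [taylor_eval] at hqv, fun j => ?_⟩
      have := hfv j
      rwa [taylor_eval] at this

theorem order_ac_pow_mul {a x : LaurentSeries K} (ha : a ≠ 0) (N : ℕ) {z : ℤ} {c : K} {s : Prop}
    [Decidable s] (hs : s ↔ c = 0) (hz : s → z = 0) :
    (x.order = z ∧ ac x = c) ↔ (a ^ N * x).order = (if s then 0 else N * a.order + z) ∧
      ac (a ^ N * x) = (if s then 0 else ac a ^ N * c) := by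
  have ha' : ac a ^ N ≠ 0 := pow_ne_zero _ fun h => ha (ac_eq_zero.1 h)
  by_cases hx : x = 0
  · subst hx
    rw [mul_zero, ac_zero, HahnSeries.order_zero]
    by_cases h : s
    · simp [h, hz h, hs.1 h]
    · have hc : c ≠ 0 := fun h' => h (hs.2 h')
      simp [h, ha', hc, hc.symm]
  · have hx' : ac x ≠ 0 := fun h => hx (ac_eq_zero.1 h)
    have hl := ((Lead.refl a).pow N).mul (Lead.refl x)
    rw [hl.order_eq (mul_ne_zero ha' hx'), hl.ac_eq (mul_ne_zero ha' hx')]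
    by_cases h : s
    · simp [h, hs.1 h, hx', ha']
    · simp [h, mul_right_inj' ha']

end

end

section

variable {ι κ : Type}

open Polynomial

/-- The possible initial forms of a polynomial with respect to a slope `γ`. -/
theorem exists_pattern (q : Polynomial (MvPolynomial ι k)) {γ : Pt k ι κ → ℤ} (hγ : IsZ γ) :
    ∃ (I : Type) (_ : Finite I) (D : I → Pt k ι κ → Prop) (w : I → Pt k ι κ → ℤ)
      (r : I → (p : Pt k ι κ) → Polynomial p.M.K),
      (∀ i, Def (D i)) ∧ (∀ i, IsZ (w i)) ∧
      (∀ i (ξ : (p : Pt k ι κ) → p.M.K), IsK ξ → ∀ e, IsK fun p => (taylor (ξ p) (r i p)).coeff e) ∧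
      (∀ p, p.poly q ≠ 0 → ∃ i, D i p) ∧
      ∀ i p, D i p → r i p ≠ 0 ∧ Gauss (p.poly q) (γ p) (w i p) (r i p) := by
  let F := Fin (q.natDegree + 1)
  let o : F → Pt k ι κ → ℤ := fun j p => (p.vf (q.coeff j)).order + (j : ℕ) * γ p
  have ho : ∀ j, IsZ (o j) := fun j => (IsZ.order _).add (hγ.smul _)
  refine ⟨F × Finset F, inferInstance, fun i p => i.1 ∈ i.2 ∧ ∀ j,
      (j ∈ i.2 ∧ p.vf (q.coeff j) ≠ 0 ∧ o j p = o i.1 p) ∨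
      (j ∉ i.2 ∧ (p.vf (q.coeff j) = 0 ∨ o i.1 p < o j p)),
    fun i => o i.1, fun i p => ∑ j : F, monomial j (if j ∈ i.2 then ac (p.vf (q.coeff j)) else 0),
    fun i => (Def.prop _).and (Def.all fun j => ((Def.prop _).and ((Def.vf_eq_zero _).not.and
      (Def.eqZ (ho j) (ho i.1)))).or ((Def.prop _).and ((Def.vf_eq_zero _).or
      (Def.lt (ho i.1) (ho j))))), fun i => ho i.1, fun i ξ hξ e => ?_, fun p hp => ?_,
    fun i p hD => ?_⟩
  · simp only [taylor_coeff]
    simp only [map_sum, hasseDeriv_monomial, eval_finsetSum, eval_monomial]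
    refine IsK.sum _ fun j => ((IsK.nat _).mul ?_).mul (hξ.pow _)
    by_cases hj : j ∈ i.2
    · simp only [hj, if_true]
      exact IsK.ac _
    · simp only [hj, if_false]
      exact IsK.zero
  · let T : Finset F := Finset.univ.filter fun j => p.vf (q.coeff j) ≠ 0
    have hT : T.Nonempty := by
      by_contra hT
      refine hp (Polynomial.ext fun j => ?_)
      rw [coeff_map, coeff_zero]
      by_cases hj : j < q.natDegree + 1
      · by_contra h
        exact hT ⟨⟨j, hj⟩, by simp only [T, Finset.mem_filter_univ]; exact h⟩
      · rw [coeff_eq_zero_of_natDegree_lt (by omega), map_zero]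
    obtain ⟨j₀, hj₀, hmin⟩ := T.exists_min_image (fun j => o j p) hT
    refine ⟨(j₀, T.filter fun j => o j p = o j₀ p), by simp [hj₀], fun j => ?_⟩
    simp only [T, Finset.mem_filter, Finset.mem_univ, true_and] at hmin ⊢
    by_cases h : p.vf (q.coeff j) = 0
    · right
      exact ⟨fun h' => h'.1 h, .inl h⟩
    · rcases (hmin j h).lt_or_eq with hlt | heq
      · right
        exact ⟨fun h' => hlt.ne' h'.2, .inr hlt⟩
      · left
        exact ⟨⟨h, heq.symm⟩, h, heq.symm⟩
  · obtain ⟨hi, hD⟩ := hD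
    have hc : ∀ j : F, (∑ j : F, monomial (j : ℕ)
        (if j ∈ i.2 then ac (p.vf (q.coeff j)) else 0)).coeff j =
          if j ∈ i.2 then ac (p.vf (q.coeff j)) else 0 := by
      intro j
      rw [finsetSum_coeff, Finset.sum_eq_single j]
      · rw [coeff_monomial_same]
      · intro l _ hl
        rw [coeff_monomial_of_ne _ fun h => hl (Fin.ext h.symm)]
      · simp
    refine ⟨fun h => ?_, fun j => ?_⟩
    · have := hc i.1
      beta_reduce at h
      rw [h, if_pos hi, coeff_zero] at this
      rcases hD i.1 with h' | h'
      · exact h'.2.1 (ac_eq_zero.1 this.symm)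
      · exact h'.1 hi
    · beta_reduce
      rw [coeff_map]
      by_cases hj : j < q.natDegree + 1
      · have := hc ⟨j, hj⟩
        dsimp only at this
        rw [this]
        rcases hD ⟨j, hj⟩ with ⟨h1, h2, h3⟩ | ⟨h1, h2⟩
        · rw [if_pos h1, ← h3]
          simp only [o, add_sub_cancel_right]
          exact Lead.refl _
        · rw [if_neg h1]
          rcases h2 with h2 | h2
          · dsimp only at h2
            rw [h2]
            exact Lead.zero _
          · refine (Lead.refl _).of_lt ?_
            simp only [o] at h2 ⊢
            linarith
      · rw [coeff_eq_zero_of_natDegree_lt (by omega), map_zero, finsetSum_coeff,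
          Finset.sum_eq_zero]
        · exact Lead.zero _
        · intro l _
          exact coeff_monomial_of_ne _ (by have := l.2; omega)

/-- Leading term conditions on polynomials of degree less than `D` can be eliminated. -/
def HasElim (k : Type) [Field k] (D : ℕ) : Prop :=
  ∀ (ι κ J : Type) [Finite J] (g : J → Polynomial (MvPolynomial ι k))
    (q : Polynomial (MvPolynomial ι k)) (γ ω : Pt k ι κ → ℤ) (ξ η : (p : Pt k ι κ) → p.M.K)
    (z : J → Pt k ι κ → ℤ) (c : J → (p : Pt k ι κ) → p.M.K) (e : J → ℕ),
    (∀ j, (g j).natDegree < D) → IsZ γ → IsZ ω → IsK ξ → IsK η → (∀ j, IsZ (z j)) →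
    (∀ j, IsK (c j)) → ∃ Q : Pt k ι κ → Prop, Def Q ∧ ∀ p,
      Adm (fun j => p.poly (g j)) (p.poly q) (γ p) (ξ p) (ω p) (η p) e →
      (Q p ↔ Match (fun j => p.poly (g j)) (p.poly q) (γ p) (ξ p) (fun j => z j p)
        (fun j => c j p))

theorem exists_def_root {γ ω : Pt k ι κ → ℤ} {ξ η : (p : Pt k ι κ) → p.M.K} (hγ : IsZ γ)
    (hω : IsZ ω) (hξ : IsK ξ) (hη : IsK η) {P : Pt k (Option ι) κ → Prop} (hP : Def P) :
    ∀ (n : ℕ) (q : Polynomial (MvPolynomial ι k)), q.natDegree ≤ n → (∀ d ≤ n, HasElim k d) →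
    ∃ Q : Pt k ι κ → Prop, Def Q ∧ ∀ p, ξ p ≠ 0 →
      LinRoot (p.poly q) (γ p) (ξ p) (ω p) (η p) →
      (Q p ↔ ∃ β, Lead β (γ p) (ξ p) ∧ (p.poly q).eval β = 0 ∧ P (p.push β)) := by
  intro n
  induction n with
  | zero =>
    intro q hq _
    refine ⟨_, Def.prop False, fun p _ h => ?_⟩
    obtain ⟨-, α, -, h0, -⟩ := id h
    refine absurd ?_ h.ne_zero
    rw [eq_C_of_natDegree_le_zero hq, Pt.poly, map_C, eval_C] at h0
    rw [eq_C_of_natDegree_le_zero hq, Pt.poly, map_C, h0, C_0]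
  | succ n ih =>
    intro q hq hM
    by_cases hq' : q.natDegree ≤ n
    · exact ih q hq' fun d hd => hM d (by omega)
    have hd : q.natDegree = n + 1 := by omega
    have hq0 : q ≠ 0 := by
      rintro rfl
      simp at hd
    obtain ⟨L, hL, f, P', hP', hsplit⟩ := hP.split
    obtain ⟨Q₀, hQ₀, h₀⟩ := ih q.eraseLead (q.eraseLead_natDegree_le.trans (by omega))
      fun d hd => hM d (by omega)
    choose N h r hdiv hdeg using fun l => exists_pseudoDivision q hq0 (f l)
    set a := q.leadingCoeff with ha
    have hr : ∀ l, (r l).natDegree < n + 1 := fun l => by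
      by_cases h0 : r l = 0
      · simp [h0]
      · rw [← hd]
        exact natDegree_lt_natDegree h0 (hdeg l)
    choose Q hQ hQ' using fun s : L → Bool => hM (n + 1) le_rfl ι (κ ⊕ L) L r q
      (fun p => γ p.base) (fun p => ω p.base) (fun p => ξ p.base) (fun p => η p.base)
      (fun l p => if s l then 0 else N l * (p.vf a).order + p.z (.inr l))
      (fun l p => if s l then 0 else ac (p.vf a) ^ N l * p.c (.inr l))
      (fun _ => n + 1) hr hγ.base hω.base hξ.base hη.base
      (fun l => by
        by_cases hs : s l
        · simp only [hs, if_true]; exact .const 0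
        · simp only [hs]; exact ((IsZ.order a).smul _).add (.var _))
      (fun l => by
        by_cases hs : s l
        · simp only [hs, if_true]; exact .zero
        · simp only [hs]; exact ((IsK.ac a).pow _).mul (.var _))
    have hQ₁ := (hP'.and (Def.ex fun s : L → Bool => (Def.all fun l : L =>
      (Def.bool (J := Unit) (fun _ => Def.eq_zero (IsK.var (Sum.inr l)))
        (fun b => (s l = true ↔ b ()))).and
      (Def.bool (J := Unit) (fun _ => Def.eqZ (IsZ.var (Sum.inr l)) (IsZ.const 0))
        (fun b => (s l = true → b ())))).and (hQ s))).exRV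
    refine ⟨_, ((Def.vf_eq_zero a).and hQ₀).or ((Def.vf_eq_zero a).not.and hQ₁), fun p hξp hp => ?_⟩
    by_cases hap : p.vf a = 0
    · have he : p.poly q.eraseLead = p.poly q := by
        conv_rhs => rw [← q.eraseLead_add_C_mul_X_pow]
        rw [Pt.poly, Pt.poly, Polynomial.map_add, Polynomial.map_mul, map_C, ← ha, hap, C_0, zero_mul,
          add_zero]
      have := h₀ p hξp (by rwa [he])
      rw [he] at this
      simpa only [hap, true_and, not_true, false_and, or_false] using this
    · simp only [hap, false_and, false_or, not_false_eq_true, true_and]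
      have hval : ∀ β, (p.poly q).eval β = 0 → ∀ l,
          (p.poly (r l)).eval β = p.vf a ^ N l * (p.poly (f l)).eval β := by
        intro β hβ l
        have := congrArg (fun F => (p.poly F).eval β) (hdiv l)
        simp only [Pt.poly, Polynomial.map_mul, Polynomial.map_add, eval_mul, eval_add, map_C,
          Polynomial.map_pow, C_pow, eval_pow, eval_C] at this hβ ⊢
        rw [this, hβ, mul_zero, zero_add]
      have hadm : Adm (fun l => p.poly (r l)) (p.poly q) (γ p) (ξ p) (ω p) (η p)
          (fun _ => n + 1) :=
        ⟨hξp, .inr hp, fun l w r' hg hr' => exists_taylor_coeff_ne_zero hr'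
          ((hg.natDegree_le_natDegree.trans natDegree_map_le).trans (hr l).le) _⟩
      constructor
      · rintro ⟨z, c, hzc, s, hs, hQs⟩
        obtain ⟨u, hu, hqu, hru⟩ := (hQ' s (p.ext z c) hadm).1 hQs
        refine ⟨u, hu, hqu, (hsplit p u).2 ?_⟩
        have : ∀ l, ((p.poly (f l)).eval u).order = z l ∧ ac ((p.poly (f l)).eval u) = c l := by
          intro l
          have hl := hru l
          beta_reduce at hl
          rw [hval u hqu] at hl
          exact (order_ac_pow_mul hap (N l) (hs l).1 (hs l).2).2 hl
        simpa only [this] using hzc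
      · rintro ⟨u, hu, hqu, hPu⟩
        let s : L → Bool := fun l => decide (ac ((p.poly (f l)).eval u) = 0)
        have hs : ∀ l, s l = true ↔ ac ((p.poly (f l)).eval u) = 0 := fun l => decide_eq_true_iff
        have hz : ∀ l, s l = true → ((p.poly (f l)).eval u).order = 0 := fun l h => by
          rw [ac_eq_zero.1 ((hs l).1 h), HahnSeries.order_zero]
        refine ⟨_, _, (hsplit p u).1 hPu, s, fun l => ⟨hs l, hz l⟩, (hQ' s (p.ext _ _) hadm).2
          ⟨u, hu, hqu, fun l => ?_⟩⟩
        rw [hval u hqu]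
        exact (order_ac_pow_mul hap (N l) (hs l) (hz l)).1 ⟨rfl, rfl⟩

end

section

variable {ι κ : Type}

open Polynomial

theorem Mdl.charZero [CharZero k] (M : Mdl k) : CharZero M.K :=
  charZero_of_injective_ringHom M.σ.injective

theorem Pt.vf_coeff_zero_recenter (p : Pt k ι κ) (y : LaurentSeries p.M.K)
    (q : Polynomial (MvPolynomial ι k)) :
    (p.push y).vf ((recenter q).coeff 0) = (p.poly q).eval y := by
  have := congrArg (fun F => Polynomial.coeff F 0) (p.poly_recenter y q)
  simpa only [coeff_map, taylor_coeff_zero] using this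

theorem Pt.poly_hasseDeriv (p : Pt k ι κ) (n : ℕ) (q : Polynomial (MvPolynomial ι k)) :
    p.poly (hasseDeriv n q) = hasseDeriv n (p.poly q) := by
  ext1 i
  simp only [Pt.poly, coeff_map, hasseDeriv_coeff, map_mul, map_natCast]

theorem hasElim_of_lt [CharZero k] {D : ℕ} (hD : ∀ d < D, HasElim k d) : HasElim k D := by
  intro ι κ J hJ
  cases nonempty_fintype J
  have key : ∀ (N : ℕ) (ι κ : Type) (g : J → Polynomial (MvPolynomial ι k))
      (q : Polynomial (MvPolynomial ι k)) (γ ω : Pt k ι κ → ℤ) (ξ η : (p : Pt k ι κ) → p.M.K)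
      (z : J → Pt k ι κ → ℤ) (c : J → (p : Pt k ι κ) → p.M.K) (e : J → ℕ), ∑ j, e j < N →
      (∀ j, (g j).natDegree < D) → IsZ γ → IsZ ω → IsK ξ → IsK η → (∀ j, IsZ (z j)) →
      (∀ j, IsK (c j)) → ∃ Q : Pt k ι κ → Prop, Def Q ∧ ∀ p,
        Adm (fun j => p.poly (g j)) (p.poly q) (γ p) (ξ p) (ω p) (η p) e →
        (Q p ↔ Match (fun j => p.poly (g j)) (p.poly q) (γ p) (ξ p) (fun j => z j p)
          (fun j => c j p)) := by
    intro N
    induction N with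
    | zero => intro _ _ _ _ _ _ _ _ _ _ _ h; omega
    | succ N ih =>
      intro ι κ g q γ ω ξ η z c e hN hg hγ hω hξ hη hz hc
      choose I hI A w r hA hw hr hcov hpat using fun j => exists_pattern (g j) hγ
      have hτ : ∀ j i m, IsK fun p => (taylor (ξ p) (r j i p)).coeff m := fun j i => hr j i ξ hξ
      have hG : ∀ p j, p.poly (g j) ≠ 0 → ∃ w r, r ≠ 0 ∧ Gauss (p.poly (g j)) (γ p) w r :=
        fun p j hj => by
          obtain ⟨i, hi⟩ := hcov j p hj
          exact ⟨_, _, hpat j i p hi⟩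
      -- the case where `ξ` is a zero of the initial form of `g j` of multiplicity `n + 1`
      have hcoll : ∀ x : Σ j, I j × Fin (e j), ∃ Q : Pt k ι κ → Prop, Def Q ∧ ∀ p,
          Adm (fun j => p.poly (g j)) (p.poly q) (γ p) (ξ p) (ω p) (η p) e →
          (A x.1 x.2.1 p ∧ (∀ m : Fin (x.2.2 + 1), (taylor (ξ p) (r x.1 x.2.1 p)).coeff m = 0) ∧
            (taylor (ξ p) (r x.1 x.2.1 p)).coeff (x.2.2 + 1) ≠ 0) →
          (Q p ↔ Match (fun j => p.poly (g j)) (p.poly q) (γ p) (ξ p) (fun j => z j p)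
            (fun j => c j p)) := by
        rintro ⟨j, i, n, hn⟩
        dsimp only
        have hlt : ∑ l, Function.update e j n l < N := by
          refine lt_of_lt_of_le (Finset.sum_lt_sum (g := e) (fun l _ => ?_)
            ⟨j, Finset.mem_univ j, by simpa using hn⟩) (Nat.lt_succ_iff.1 hN)
          by_cases hl : l = j
          · subst hl
            simpa using hn.le
          · simp [hl]
        obtain ⟨Q₁, hQ₁, h₁⟩ := ih (Option ι) (κ ⊕ Unit) (fun l => recenter (g l)) (recenter q)
          (fun p => p.z (.inr ())) (fun p => ω p.base.pop) (fun p => p.c (.inr ()))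
          (fun p => η p.base.pop) (fun l p => z l p.base.pop) (fun l p => c l p.base.pop)
          (Function.update e j n) hlt
          (fun l => (natDegree_recenter_le _).trans_lt (hg l)) (.var _) hω.pop.base (.var _)
          hη.pop.base (fun l => (hz l).pop.base) (fun l => (hc l).pop.base)
        obtain ⟨R, hR, hRe⟩ : ∃ R : Pt k (Option ι) κ → Prop, Def R ∧ ∀ (p : Pt k ι κ) β,
            R (p.push β) ↔ ((p.poly q).eval β = 0 ∧ ∀ l, ((p.poly (g l)).eval β).order = z l p ∧
                ac ((p.poly (g l)).eval β) = c l p) ∨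
              ∃ γ' ξ', γ p < γ' ∧ ξ' ≠ 0 ∧ (p.poly q = 0 ∨ (p.poly q).eval β ≠ 0 ∧
                ((p.poly q).eval β).order = ω p + γ' ∧ ac ((p.poly q).eval β) = -(η p * ξ')) ∧
                Q₁ ((p.push β).ext (fun _ => γ') (fun _ => ξ')) := by
          let q₀ := (recenter q).coeff 0
          refine ⟨_, ((Def.vf_eq_zero q₀).and (Def.all fun l : J =>
            (Def.eqZ (IsZ.order ((recenter (g l)).coeff 0)) (hz l).pop).and
            (Def.eqK (IsK.ac ((recenter (g l)).coeff 0)) (hc l).pop))).or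
            (((Def.lt hγ.pop.base (IsZ.var (Sum.inr ()))).and
              ((Def.eq_zero (IsK.var (Sum.inr ()))).not.and
              (((Def.poly_eq_zero (recenter q)).base.or ((Def.vf_eq_zero q₀).base.not.and
                ((Def.eqZ (IsZ.order q₀).base (hω.pop.base.add (IsZ.var (Sum.inr ())))).and
                (Def.eqK (IsK.ac q₀).base (hη.pop.base.mul (IsK.var (Sum.inr ()))).neg)))).and
                hQ₁)))).exRV, fun p β => or_congr ?_ ?_⟩
          · have hb := p.vf_coeff_zero_recenter β
            rw [← hb q]
            refine and_congr Iff.rfl (forall_congr' fun l => ?_)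
            rw [← hb (g l)]
            rfl
          · have h0 : (p.push β).poly (recenter q) = 0 ↔ p.poly q = 0 := by
              rw [Pt.poly_recenter, map_eq_zero_iff _ (taylor_injective β)]
            have hb := p.vf_coeff_zero_recenter β q
            constructor
            · rintro ⟨z', c', h1, h2, h3, h4⟩
              refine ⟨z' (), c' (), h1, h2, ?_, h4⟩
              rw [← h0, ← hb]
              exact h3
            · rintro ⟨γ', ξ', h1, h2, h3, h4⟩
              refine ⟨fun _ => γ', fun _ => ξ', h1, h2, ?_, h4⟩
              rw [← h0, ← hb] at h3
              exact h3
        obtain ⟨Q, hQ, h⟩ := exists_def_root hγ ((((hw j i).sub (hγ.smul n)).sub hγ)) hξ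
          ((IsK.nat (n + 1)).mul (hτ j i (n + 1))) hR (g j).natDegree (hasseDeriv n (g j))
          ((natDegree_hasseDeriv_le _ _).trans (Nat.sub_le _ _))
          fun d hd => hD d (hd.trans_lt (hg j))
        refine ⟨Q, hQ, fun p hadm hp => ?_⟩
        have := p.M.charZero
        obtain ⟨hA', hm, hn'⟩ := hp
        obtain ⟨hr0, hgauss⟩ := hpat j i p hA'
        have hlin := hgauss.linRoot_hasseDeriv (hm ⟨n, n.lt_succ_self⟩) hn'
        rw [← Pt.poly_hasseDeriv] at hlin
        have hβ : ∀ β, Lead β (γ p) (ξ p) → (p.poly (hasseDeriv n (g j))).eval β = 0 →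
            (R (p.push β) ↔ Match (fun j => p.poly (g j)) (p.poly q) (γ p) (ξ p) (fun j => z j p)
              (fun j => c j p)) := fun β hβ h0 => by
          rw [hRe, match_iff_recenter hadm.2.1 hβ]
          refine or_congr Iff.rfl (exists_congr fun γ' => exists_congr fun ξ' =>
            and_congr_right fun hlt => and_congr_right fun hξ' => and_congr_right fun hq => ?_)
          rw [Pt.poly_hasseDeriv] at h0
          have h2 := hadm.recenter (hG p) hβ hgauss hn' h0 hlt hξ' hq
          have hp : ∀ F, ((p.push β).ext (fun _ : Unit => γ') (fun _ => ξ')).poly (recenter F) =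
              taylor β (p.poly F) := fun F => p.poly_recenter β F
          have h3 := h₁ ((p.push β).ext (fun _ => γ') (fun _ => ξ'))
          simp only [hp] at h3
          exact h3 h2
        rw [h p hadm.1 hlin]
        constructor
        · rintro ⟨β, h1, h2, h3⟩
          exact (hβ β h1 h2).1 h3
        · intro hm
          obtain ⟨-, β, h1, h2, -⟩ := hlin
          exact ⟨β, h1, h2, (hβ β h1 h2).2 hm⟩
      choose Q₂ hQ₂ h₂ using hcoll
      refine Def.glue (I := Option (Σ j, I j × Fin (e j)))
        (C := fun o p => o.elim (∀ j, p.poly (g j) = 0 ∨ ∃ i, A j i p ∧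
            (taylor (ξ p) (r j i p)).coeff 0 ≠ 0)
          fun x => A x.1 x.2.1 p ∧
            (∀ m : Fin (x.2.2 + 1), (taylor (ξ p) (r x.1 x.2.1 p)).coeff m = 0) ∧
            (taylor (ξ p) (r x.1 x.2.1 p)).coeff (x.2.2 + 1) ≠ 0)
        (Q := fun o p => o.elim (∀ j, (p.poly (g j) = 0 ∧ z j p = 0 ∧ c j p = 0) ∨
            ∃ i, A j i p ∧ (taylor (ξ p) (r j i p)).coeff 0 ≠ 0 ∧ z j p = w j i p ∧
              c j p = (taylor (ξ p) (r j i p)).coeff 0) fun x => Q₂ x p) ?_ ?_ ?_ ?_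
      · rintro (_ | ⟨j, i, n⟩)
        · exact Def.all fun j => (Def.poly_eq_zero _).or
            (Def.ex fun i => (hA j i).and (Def.eq_zero (hτ j i 0)).not)
        · exact (hA j i).and ((Def.all fun m : Fin (n + 1) => Def.eq_zero (hτ j i m)).and
            (Def.eq_zero (hτ j i _)).not)
      · rintro (_ | x)
        · exact Def.all fun j => ((Def.poly_eq_zero _).and ((Def.eqZ (hz j) (.const 0)).and
            (Def.eq_zero (hc j)))).or (Def.ex fun i => (hA j i).and
              ((Def.eq_zero (hτ j i 0)).not.and ((Def.eqZ (hz j) (hw j i)).and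
                (Def.eqK (hc j) (hτ j i 0)))))
        · exact hQ₂ x
      · intro p hadm
        by_cases hno : ∀ j, p.poly (g j) = 0 ∨ ∃ i, A j i p ∧
            (taylor (ξ p) (r j i p)).coeff 0 ≠ 0
        · exact ⟨none, hno⟩
        · push Not at hno
          obtain ⟨j, hj, h0⟩ := hno
          obtain ⟨i, hi⟩ := hcov j p hj
          obtain ⟨hr0, hgauss⟩ := hpat j i p hi
          have hex : ∃ m, (taylor (ξ p) (r j i p)).coeff m ≠ 0 ∧ m ≤ e j := by
            obtain ⟨m, hm, hm'⟩ := hadm.2.2 j _ _ hgauss hr0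
            exact ⟨m, hm', hm⟩
          obtain ⟨n, hn⟩ : ∃ n, Nat.find hex = n + 1 := by
            refine Nat.exists_eq_succ_of_ne_zero fun h => ?_
            have := (Nat.find_spec hex).1
            rw [h] at this
            exact this (h0 i hi)
          have hs := Nat.find_spec hex
          have hmin := fun m => Nat.find_min hex (m := m)
          rw [hn] at hs hmin
          refine ⟨some ⟨j, i, n, hs.2⟩, hi, fun m => ?_, hs.1⟩
          by_contra hm
          have hm2 := m.2
          dsimp only at hm2
          exact hmin m hm2 ⟨hm, by omega⟩
      · rintro (_ | x) p hadm hC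
        · have hev : ∀ j i u, A j i p → (taylor (ξ p) (r j i p)).coeff 0 ≠ 0 →
              Lead u (γ p) (ξ p) → ((p.poly (g j)).eval u).order = w j i p ∧
                ac ((p.poly (g j)).eval u) = (taylor (ξ p) (r j i p)).coeff 0 := by
            intro j i u hi h0 hu
            have := (hpat j i p hi).2.eval hu
            rw [← taylor_coeff_zero (ξ p) (r j i p)] at this
            exact ⟨this.order_eq h0, this.ac_eq h0⟩
          constructor
          · intro hQ
            obtain ⟨u, hu, hqu⟩ : ∃ u, Lead u (γ p) (ξ p) ∧ (p.poly q).eval u = 0 := by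
              rcases hadm.2.1 with h | ⟨-, α, h1, h2, -⟩
              · exact ⟨_, Lead.single _ _, by rw [h, eval_zero]⟩
              · exact ⟨α, h1, h2⟩
            refine ⟨u, hu, hqu, fun j => ?_⟩
            rcases hQ j with ⟨h1, h2, h3⟩ | ⟨i, h1, h2, h3, h4⟩
            · beta_reduce
              rw [h1, eval_zero, h2, h3]
              exact ⟨HahnSeries.order_zero, ac_zero⟩
            · beta_reduce
              rw [h3, h4]
              exact hev j i u h1 h2 hu
          · rintro ⟨u, hu, -, hf⟩ j
            obtain ⟨hf1, hf2⟩ := hf j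
            beta_reduce at hf1 hf2
            rcases hC j with h | ⟨i, h1, h2⟩
            · rw [h, eval_zero] at hf1 hf2
              exact .inl ⟨h, hf1.symm.trans HahnSeries.order_zero, hf2.symm.trans ac_zero⟩
            · obtain ⟨h3, h4⟩ := hev j i u h1 h2 hu
              exact .inr ⟨i, h1, h2, hf1.symm.trans h3, hf2.symm.trans h4⟩
        · exact h₂ x p hadm hC
  exact fun g q γ ω ξ η z c e => key _ ι κ g q γ ω ξ η z c e (Nat.lt_succ_self _)

theorem hasElim [CharZero k] (D : ℕ) : HasElim k D :=
  Nat.strong_induction_on D fun _ h => hasElim_of_lt h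

/-- Elimination of a valued field variable. -/
theorem Def.exVF [CharZero k] {P : Pt k (Option ι) κ → Prop} (hP : Def P) :
    Def (fun p : Pt k ι κ => ∃ y, P (p.push y)) := by
  obtain ⟨L, hL, f, P', hP', hsplit⟩ := hP.split
  cases nonempty_fintype L
  let D := (∑ l, (f l).natDegree) + 1
  have hD : ∀ l, (f l).natDegree < D := fun l =>
    Nat.lt_succ_iff.2 (Finset.single_le_sum (f := fun l => (f l).natDegree)
      (fun _ _ => Nat.zero_le _) (Finset.mem_univ l))
  obtain ⟨Q, hQ, h⟩ := hasElim (k := k) D ι ((κ ⊕ L) ⊕ Unit) L f 0 (fun p => p.z (.inr ()))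
    (fun _ => 0) (fun p => p.c (.inr ())) (fun _ => 0) (fun l p => p.z (.inl (.inr l)))
    (fun l p => p.c (.inl (.inr l))) (fun _ => D) hD (.var _) (.const 0) (.var _) .zero
    (fun _ => .var _) (fun _ => .var _)
  refine ((hP.push_vf 0).or (hP'.base.and
    ((Def.eq_zero (IsK.var (Sum.inr ()))).not.and hQ)).exRV.exRV).congr fun p => ?_
  have hadm : ∀ (γ : ℤ) (ξ : p.M.K), ξ ≠ 0 →
      Adm (fun l => p.poly (f l)) (p.poly 0) γ ξ 0 0 (fun _ => D) := fun γ ξ hξ =>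
    ⟨hξ, .inl (Polynomial.map_zero _), fun l w r hg hr => exists_taylor_coeff_ne_zero hr
      ((hg.natDegree_le_natDegree.trans natDegree_map_le).trans (hD l).le) ξ⟩
  constructor
  · rintro ⟨y, hy⟩
    by_cases hy0 : y = 0
    · left
      rwa [map_zero, ← hy0]
    · have hy1 : ac y ≠ 0 := fun h => hy0 (ac_eq_zero.1 h)
      exact .inr ⟨_, _, fun _ => y.order, fun _ => ac y, (hsplit p y).1 hy, hy1,
        (h ((p.ext _ _).ext (fun _ => y.order) (fun _ => ac y)) (hadm _ _ hy1)).2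
          ⟨y, Lead.refl y, by rw [Pt.poly, Polynomial.map_zero, eval_zero], fun l => ⟨rfl, rfl⟩⟩⟩
  · rintro (hy | ⟨z, c, γ, ξ, hP, hξ, hQ⟩)
    · exact ⟨_, hy⟩
    · obtain ⟨u, -, -, hu⟩ := (h ((p.ext z c).ext γ ξ) (hadm _ _ hξ)).1 hQ
      refine ⟨u, (hsplit p u).2 ?_⟩
      have hu' : ∀ l, ((p.poly (f l)).eval u).order = z l ∧ ac ((p.poly (f l)).eval u) = c l := hu
      simp only [hu']
      exact hP

end

section

variable {ι κ : Type} {m r : ℕ}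

theorem Def.reindex {ι' : Type} (e : ι → ι') {P : Pt k ι κ → Prop} (h : Def P) :
    Def (fun p : Pt k ι' κ => P ⟨p.M, fun i => p.x (e i), p.z, p.c⟩) := by
  obtain ⟨R, hR, hP⟩ := h
  have hf : ∀ (p : Pt k ι' κ) f, (⟨p.M, fun i => p.x (e i), p.z, p.c⟩ : Pt k ι κ).vf f =
      p.vf (MvPolynomial.rename e f) := by
    intro p f
    simp only [Pt.vf, MvPolynomial.coe_eval₂Hom, MvPolynomial.eval₂_rename]
    rfl
  refine ⟨_, hR.rename (Sum.map (MvPolynomial.rename e) id) (Sum.map (MvPolynomial.rename e) id),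
    fun p => ?_⟩
  beta_reduce
  rw [hP]
  refine iff_of_eq ?_
  congr 1 <;> (
    funext i
    rcases i with i | i
    · first | exact congrArg HahnSeries.order (hf p i) | exact congrArg Pas.ac (hf p i)
    · rfl)

theorem IsZ.affineForm (L : AffineForm r) : IsZ (fun p : Pt k ι (Fin r) => L.eval p.z) := by
  refine (IsZ.const L.c).add ?_
  induction (Finset.univ : Finset (Fin r)) using Finset.induction_on with
  | empty => exact .const 0
  | insert i s hi ih =>
    simp only [Finset.sum_insert hi]
    exact ((IsZ.var i).smul (L.a i)).add ih

theorem ordT_of_ne_zero {K : Type} [Field K] {x : LaurentSeries K} (h : x ≠ 0) :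
    ordT x = (x.order : WithTop ℤ) := if_neg h

/-- Semi-algebraic conditions are definable. -/
theorem Cond.isDef (θ : Cond k m r) :
    Def (fun p : Pt k (Fin m) (Fin r) => θ.Holds p.M.σ p.x p.z) := by
  induction θ with
  | ordGe f₁ f₂ L =>
    refine ((Def.vf_eq_zero f₁).or ((Def.vf_eq_zero f₂).not.and
      (Def.le ((IsZ.order f₂).add (.affineForm L)) (IsZ.order f₁)))).congr fun p => ?_
    change ordT (p.vf f₂) + (L.eval p.z : WithTop ℤ) ≤ ordT (p.vf f₁) ↔ _
    by_cases h₁ : p.vf f₁ = 0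
    · simp [h₁, ordT]
    · by_cases h₂ : p.vf f₂ = 0
      · rw [ordT_of_ne_zero h₁]
        simp only [h₁, h₂, ordT, if_true, top_add, top_le_iff, WithTop.coe_ne_top, not_true_eq_false,
          false_and, or_self]
      · rw [ordT_of_ne_zero h₁, ordT_of_ne_zero h₂, ← WithTop.coe_add, WithTop.coe_le_coe]
        simp only [h₁, h₂, false_or, not_false_eq_true, true_and]
  | ordMod f L d =>
    refine ((Def.vf_eq_zero f).or (Def.dvd d ((IsZ.order f).sub (.affineForm L)))).congr
      fun p => ?_
    change ModCond (ordT (p.vf f)) (L.eval p.z) d ↔ _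
    by_cases h : p.vf f = 0
    · simp [h, ordT, ModCond]
    · rw [ordT_of_ne_zero h]
      simp only [ModCond, WithTop.coe_ne_top, h, false_or, WithTop.coe_inj, exists_eq_left']
  | acEq n f h =>
    refine (Def.eq_zero (f := fun p => p.M.ev (fun i => ac (p.vf (f i))) h)
      ⟨MvPolynomial.rename (fun i => .inl (f i)) h, fun p => ?_⟩).congr fun p => Iff.rfl
    exact (MvPolynomial.eval₂_rename p.M.σ (fun i => .inl (f i)) p.cs h).symm
  | not θ h => exact h.not
  | and θ₁ θ₂ h₁ h₂ => exact h₁.and h₂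
  | or θ₁ θ₂ h₁ h₂ => exact h₁.or h₂

/-- Predicates which agree with a semi-algebraic condition at the points all of whose residue
field coordinates vanish. -/
def IsCond (P : Pt k (Fin m) (Fin r) → Prop) : Prop :=
  ∃ θ : Cond k m r, ∀ p : Pt k (Fin m) (Fin r), p.c = 0 → (θ.Holds p.M.σ p.x p.z ↔ P p)

namespace IsCond

variable {P P' : Pt k (Fin m) (Fin r) → Prop}

theorem congr (h : IsCond P) (e : ∀ p, P' p ↔ P p) : IsCond P' := by
  obtain ⟨θ, h⟩ := h
  exact ⟨θ, fun p hp => (h p hp).trans (e p).symm⟩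

theorem not (h : IsCond P) : IsCond (fun p => ¬ P p) := by
  obtain ⟨θ, h⟩ := h
  exact ⟨.not θ, fun p hp => not_congr (h p hp)⟩

theorem and (h : IsCond P) (h' : IsCond P') : IsCond (fun p => P p ∧ P' p) := by
  obtain ⟨θ, h⟩ := h
  obtain ⟨θ', h'⟩ := h'
  exact ⟨.and θ θ', fun p hp => and_congr (h p hp) (h' p hp)⟩

theorem or (h : IsCond P) (h' : IsCond P') : IsCond (fun p => P p ∨ P' p) := by
  obtain ⟨θ, h⟩ := h
  obtain ⟨θ', h'⟩ := h'
  exact ⟨.or θ θ', fun p hp => or_congr (h p hp) (h' p hp)⟩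

theorem eq_zero (h : MvPolynomial (MvPolynomial (Fin m) k ⊕ Fin r) k) :
    IsCond (fun p : Pt k (Fin m) (Fin r) => p.M.ev p.cs h = 0) := by
  obtain ⟨n, f, -, h, rfl⟩ := MvPolynomial.exists_fin_rename h
  refine ⟨.acEq n (fun i => Sum.elim id (fun _ => 0) (f i)) h, fun p hp => ?_⟩
  beta_reduce
  rw [Mdl.ev, MvPolynomial.coe_eval₂Hom, MvPolynomial.eval₂_rename]
  refine iff_of_eq (congrArg (fun c => MvPolynomial.eval₂ p.M.σ c h = 0) (funext fun i => ?_))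
  rw [Function.comp_apply]
  beta_reduce
  rcases f i with g | j
  · rfl
  · change ac (p.vf 0) = p.c j
    rw [map_zero, hp]
    exact ac_zero

theorem true : IsCond (fun _ : Pt k (Fin m) (Fin r) => True) :=
  (eq_zero 0).congr fun p => by simp

theorem prop (S : Prop) : IsCond (fun _ : Pt k (Fin m) (Fin r) => S) := by
  by_cases h : S
  · exact true.congr fun _ => iff_true_intro h
  · exact true.not.congr fun _ => by simp [h]

theorem vf_eq_zero (f : MvPolynomial (Fin m) k) :
    IsCond (fun p : Pt k (Fin m) (Fin r) => p.vf f = 0) :=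
  (eq_zero (MvPolynomial.X (.inl f))).congr fun p => by
    rw [MvPolynomial.eval₂Hom_X']
    exact ac_eq_zero.symm

theorem bool {J : Type} [Finite J] {P : J → Pt k (Fin m) (Fin r) → Prop} (h : ∀ j, IsCond (P j))
    (S : (J → Prop) → Prop) : IsCond (fun p => S (fun j => P j p)) := by
  refine Finite.induction_empty_option (P := fun J => ∀ P : J → Pt k (Fin m) (Fin r) → Prop,
    (∀ j, IsCond (P j)) → ∀ S : (J → Prop) → Prop, IsCond (fun p => S (fun j => P j p)))
    ?_ ?_ ?_ J P h S
  · intro J J' e ih P h S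
    refine (ih (fun j => P (e j)) (fun j => h (e j)) (fun s => S (fun j => s (e.symm j)))).congr
      fun p => ?_
    simp
  · intro P h S
    refine (prop (S PEmpty.elim)).congr fun p => ?_
    rw [Subsingleton.elim (fun j => P j p) PEmpty.elim]
  · intro J _ ih P h S
    have ih' := fun A => ih (fun j => P (some j)) (fun j => h _) (fun s => S (fun o => o.elim A s))
    refine (((h none).and (ih' True)).or ((h none).not.and (ih' False))).congr fun p => ?_
    have hP : (fun j => P j p) = fun o => o.elim (P none p) (fun j => P (some j) p) := by
      funext o
      cases o <;> rfl
    rw [hP]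
    by_cases h0 : P none p <;> simp [h0]

theorem ex {J : Type} [Finite J] {P : J → Pt k (Fin m) (Fin r) → Prop} (h : ∀ j, IsCond (P j)) :
    IsCond (fun p => ∃ j, P j p) := bool h (fun s => ∃ j, s j)

end IsCond

theorem AffineForm.eval_neg (L : AffineForm r) (ℓ : Fin r → ℤ) :
    AffineForm.eval ⟨-L.c, fun i => -L.a i⟩ ℓ = -L.eval ℓ := by
  simp only [eval, neg_mul, Finset.sum_neg_distrib]
  ring

theorem AffineForm.eval_add (L L' : AffineForm r) (ℓ : Fin r → ℤ) :
    AffineForm.eval ⟨L.c + L'.c, fun i => L.a i + L'.a i⟩ ℓ = L.eval ℓ + L'.eval ℓ := by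
  simp only [eval, add_mul, Finset.sum_add_distrib]
  ring

theorem AffineForm.eval_smul (n : ℤ) (L : AffineForm r) (ℓ : Fin r → ℤ) :
    AffineForm.eval ⟨n * L.c, fun i => n * L.a i⟩ ℓ = n * L.eval ℓ := by
  simp only [eval, mul_assoc, ← Finset.mul_sum]
  ring

/-- Integer valued functions which are piecewise the sum of a difference of orders and an affine
form in the integer coordinates. -/
def IsPiecewise (f : Pt k (Fin m) (Fin r) → ℤ) : Prop :=
  ∃ (I : Type) (_ : Finite I) (C : I → Pt k (Fin m) (Fin r) → Prop)
    (F G : I → MvPolynomial (Fin m) k) (L : I → AffineForm r), (∀ i, IsCond (C i)) ∧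
    (∀ p, ∃ i, C i p) ∧ ∀ i p, C i p → p.vf (F i) ≠ 0 ∧ p.vf (G i) ≠ 0 ∧
      f p = (p.vf (F i)).order - (p.vf (G i)).order + (L i).eval p.z

namespace IsPiecewise

theorem affineForm (L : AffineForm r) : IsPiecewise (fun p : Pt k (Fin m) (Fin r) => L.eval p.z) :=
  ⟨Unit, inferInstance, fun _ _ => True, 1, 1, fun _ => L, fun _ => .true, fun _ => ⟨(), trivial⟩,
    fun _ p _ => by simp⟩

theorem order (f : MvPolynomial (Fin m) k) :
    IsPiecewise (fun p : Pt k (Fin m) (Fin r) => (p.vf f).order) := by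
  refine ⟨Bool, inferInstance, fun b p => bif b then p.vf f = 0 else p.vf f ≠ 0,
    fun b => bif b then 1 else f, 1, fun _ => ⟨0, 0⟩, ?_, fun p => ?_, ?_⟩
  · rintro (_ | _)
    · exact (IsCond.vf_eq_zero f).not
    · exact IsCond.vf_eq_zero f
  · by_cases h : p.vf f = 0
    · exact ⟨Bool.true, h⟩
    · exact ⟨Bool.false, h⟩
  · rintro (_ | _) p h
    · exact ⟨h, by simp, by simp [AffineForm.eval]⟩
    · exact ⟨by simp, by simp, by
        beta_reduce
        rw [show p.vf f = 0 from h]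
        simp [AffineForm.eval]⟩

theorem add {f f' : Pt k (Fin m) (Fin r) → ℤ} (h : IsPiecewise f) (h' : IsPiecewise f') :
    IsPiecewise (fun p => f p + f' p) := by
  obtain ⟨I, hI, C, F, G, L, hC, hc, h⟩ := h
  obtain ⟨I', hI', C', F', G', L', hC', hc', h'⟩ := h'
  refine ⟨I × I', inferInstance, fun i p => C i.1 p ∧ C' i.2 p, fun i => F i.1 * F' i.2,
    fun i => G i.1 * G' i.2, fun i => ⟨(L i.1).c + (L' i.2).c, fun j => (L i.1).a j + (L' i.2).a j⟩,
    fun i => (hC _).and (hC' _), fun p => ?_, fun ⟨i, i'⟩ p ⟨hi, hi'⟩ => ?_⟩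
  · obtain ⟨i, hi⟩ := hc p
    obtain ⟨i', hi'⟩ := hc' p
    exact ⟨(i, i'), hi, hi'⟩
  · obtain ⟨h1, h2, h3⟩ := h i p hi
    obtain ⟨h1', h2', h3'⟩ := h' i' p hi'
    simp only [map_mul, mul_ne_zero h1 h1', mul_ne_zero h2 h2', ne_eq, not_false_eq_true, true_and]
    rw [HahnSeries.order_mul h1 h1', HahnSeries.order_mul h2 h2', AffineForm.eval_add, h3, h3']
    ring

theorem neg {f : Pt k (Fin m) (Fin r) → ℤ} (h : IsPiecewise f) :
    IsPiecewise (fun p => - f p) := by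
  obtain ⟨I, hI, C, F, G, L, hC, hc, h⟩ := h
  refine ⟨I, hI, C, G, F, fun i => ⟨-(L i).c, fun j => -(L i).a j⟩, hC, hc, fun i p hi => ?_⟩
  obtain ⟨h1, h2, h3⟩ := h i p hi
  refine ⟨h2, h1, ?_⟩
  beta_reduce
  rw [AffineForm.eval_neg, h3]
  ring

theorem nsmul (n : ℕ) {f : Pt k (Fin m) (Fin r) → ℤ} (h : IsPiecewise f) :
    IsPiecewise (fun p => n * f p) := by
  obtain ⟨I, hI, C, F, G, L, hC, hc, h⟩ := h
  refine ⟨I, hI, C, fun i => F i ^ n, fun i => G i ^ n, fun i => ⟨n * (L i).c, fun j => n * (L i).a j⟩,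
    hC, hc, fun i p hi => ?_⟩
  obtain ⟨h1, h2, h3⟩ := h i p hi
  simp only [map_pow]
  refine ⟨pow_ne_zero n h1, pow_ne_zero n h2, ?_⟩
  rw [HahnSeries.order_pow, HahnSeries.order_pow, AffineForm.eval_smul, h3, nsmul_eq_mul,
    nsmul_eq_mul]
  ring

theorem smul (n : ℤ) {f : Pt k (Fin m) (Fin r) → ℤ} (h : IsPiecewise f) :
    IsPiecewise (fun p => n * f p) := by
  obtain ⟨n, rfl | rfl⟩ := n.eq_nat_or_neg
  · exact h.nsmul n
  · simpa only [neg_mul] using (h.nsmul n).neg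

theorem isAff {ℓ : (MvPolynomial (Fin m) k ⊕ Fin r → ℤ) → ℤ} (h : IsAff ℓ) :
    IsPiecewise (fun p : Pt k (Fin m) (Fin r) => ℓ p.zs) := by
  induction h with
  | const c =>
    simpa [AffineForm.eval] using affineForm (k := k) (m := m) (r := r) ⟨c, 0⟩
  | var i =>
    rcases i with f | i
    · exact order f
    · simpa [AffineForm.eval, Pt.zs, Pi.single_apply] using
        affineForm (k := k) (m := m) (r := r) ⟨0, Pi.single i 1⟩
  | add _ _ h₁ h₂ => exact h₁.add h₂
  | smul n _ h => exact h.smul n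

theorem isCond {f : Pt k (Fin m) (Fin r) → ℤ} (h : IsPiecewise f) (S : ℤ → Prop)
    (hS : ∀ F G (L : AffineForm r), ∃ θ : Cond k m r, ∀ p : Pt k (Fin m) (Fin r), p.vf F ≠ 0 →
      p.vf G ≠ 0 → (θ.Holds p.M.σ p.x p.z ↔ S ((p.vf F).order - (p.vf G).order + L.eval p.z))) :
    IsCond (fun p => S (f p)) := by
  obtain ⟨I, hI, C, F, G, L, hC, hc, h⟩ := h
  choose θ hθ using fun i => hS (F i) (G i) (L i)
  refine (IsCond.ex fun i => (hC i).and ⟨θ i, fun p _ => Iff.rfl⟩).congr fun p => ⟨fun hs => ?_, ?_⟩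
  · obtain ⟨i, hi⟩ := hc p
    obtain ⟨h1, h2, h3⟩ := h i p hi
    exact ⟨i, hi, (hθ i p h1 h2).2 (h3 ▸ hs)⟩
  · rintro ⟨i, hi, hs⟩
    obtain ⟨h1, h2, h3⟩ := h i p hi
    exact h3 ▸ (hθ i p h1 h2).1 hs

theorem nonneg {f : Pt k (Fin m) (Fin r) → ℤ} (h : IsPiecewise f) :
    IsCond (fun p => 0 ≤ f p) := by
  refine h.isCond (fun z => 0 ≤ z) fun F G L =>
    ⟨.ordGe F G ⟨-L.c, fun i => -L.a i⟩, fun p hF hG => ?_⟩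
  change ordT (p.vf G) + _ ≤ ordT (p.vf F) ↔ _
  rw [ordT_of_ne_zero hF, ordT_of_ne_zero hG, ← WithTop.coe_add, WithTop.coe_le_coe,
    AffineForm.eval_neg]
  constructor <;> intro _ <;> linarith

theorem dvd {d : ℤ} (hd : d ≠ 0) {f : Pt k (Fin m) (Fin r) → ℤ} (h : IsPiecewise f) :
    IsCond (fun p => d ∣ f p) := by
  obtain ⟨n, hn⟩ := Nat.exists_eq_succ_of_ne_zero (Int.natAbs_ne_zero.2 hd)
  refine h.isCond (fun z => d ∣ z) fun F G L =>
    ⟨.ordMod (F * G ^ n) ⟨-L.c, fun i => -L.a i⟩ d.natAbs, fun p hF hG => ?_⟩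
  have hFG := mul_ne_zero hF (pow_ne_zero n hG)
  change ModCond (ordT (p.vf (F * G ^ n))) _ _ ↔ _
  rw [map_mul, map_pow, ordT_of_ne_zero hFG, HahnSeries.order_mul hF (pow_ne_zero n hG),
    HahnSeries.order_pow, AffineForm.eval_neg, nsmul_eq_mul]
  simp only [ModCond, WithTop.coe_ne_top, false_or, WithTop.coe_inj, exists_eq_left',
    Int.natAbs_dvd]
  have hdvd : d ∣ ((n : ℤ) + 1) * (p.vf G).order := by
    refine Dvd.dvd.mul_right (Int.natAbs_dvd.1 ?_) _
    rw [hn]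
    push_cast
    exact dvd_rfl
  rw [← dvd_add_left (b := (p.vf F).order - (p.vf G).order + L.eval p.z) hdvd]
  refine iff_of_eq (congrArg (d ∣ ·) ?_)
  ring

end IsPiecewise

/-- Definable predicates are semi-algebraic. -/
theorem Def.isCond {P : Pt k (Fin m) (Fin r) → Prop} (h : Def P) : IsCond P := by
  obtain ⟨R, ⟨I, hI, A, S, hA, hS⟩, hP⟩ := h
  refine (IsCond.bool (P := fun i p => A i p.M p.zs p.cs) (fun i => ?_) S).congr
    fun p => (hP p).trans (hS _ _ _)
  have hi := hA i
  generalize A i = A at hi ⊢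
  cases hi with
  | le h => exact (IsPiecewise.isAff h).nonneg
  | dvd d hd h => exact (IsPiecewise.isAff h).dvd hd
  | eq h => exact IsCond.eq_zero h

end

/-- **Theorem 2.1 (Pas's quantifier elimination).** Let `k` be a field of
characteristic zero. If `θ(x₁,…,x_{m+1}; ℓ₁,…,ℓ_r)` is a semi-algebraic
condition, then `(∃ x₁ ∈ k̄((t))) θ(x₁,…,x_{m+1}; ℓ₁,…,ℓ_r)` is semi-algebraic;
furthermore, for any algebraically closed field `K` containing `k̄`, the
condition `(∃ x₁ ∈ K((t))) θ(x₁,…,x_{m+1}; ℓ₁,…,ℓ_r)` is also semi-algebraic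
and may be defined by the same conditions, i.e. independently of `K`. -/
theorem pas_quantifier_elimination [CharZero k] (m r : ℕ)
    (θ : Cond k (m + 1) r) :
    ∃ θ' : Cond k m r,
      ∀ (K : Type) [Field K] [IsAlgClosed K] (σ : k →+* K)
        (x : Fin m → LaurentSeries K) (ℓ : Fin r → ℤ),
        θ'.Holds σ x ℓ ↔ ∃ x₁ : LaurentSeries K, θ.Holds σ (Fin.cons x₁ x) ℓ := by
  obtain ⟨θ', h⟩ := (θ.isDef.reindex (finSuccEquiv m)).exVF.isCond
  refine ⟨θ', fun K _ _ σ x ℓ => (h ⟨⟨K, σ⟩, x, ℓ, 0⟩ rfl).trans (exists_congr fun x₁ => ?_)⟩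
  refine iff_of_eq (congrArg (fun y => θ.Holds σ y ℓ) (funext fun i => ?_))
  refine Fin.cases ?_ (fun i => ?_) i
  · simp
  · simp

end Pas
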